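/- Let $0<\mu<1$, $0<\gamma<1$ and $C>0$. Then for all sufficiently large $X$ one has $\sum_{1<q\le (\log X)^{C}}\frac{1}{\varphi(q)}\sum^{*}_{\chi\ (\mathrm{mod}\ q)}\Big|\sum_{\mu X<n\le X}\Lambda(n)\chi(n)\big((n+1)^{\gamma}-n^{\gamma}\big)\Big|\ll \frac{X^{\gamma}}{e^{(\log X)^{1/3}}}$, with the implied constant depending only on $\mu,\gamma,C$. -/

import Mathlib

open Complex Metric Set in
theorem exists_log_of_ne_zero_on_ball {f : ℂ → ℂ} {c : ℂ} {r : ℝ} (hr : 0 < r)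
    (hf : DifferentiableOn ℂ f (ball c r)) (h0 : ∀ z ∈ ball c r, f z ≠ 0) :
    ∃ g : ℂ → ℂ, g c = 0 ∧ (∀ z ∈ ball c r, HasDerivAt g (logDeriv f z) z) ∧
      ∀ z ∈ ball c r, f z = f c * exp (g z) := by
  have hld : DifferentiableOn ℂ (logDeriv f) (ball c r) := by
    have : logDeriv f = fun z => deriv f z / f z := by ext z; rfl
    rw [this]
    exact (hf.deriv isOpen_ball).div hf h0
  obtain ⟨g₀, hg₀⟩ := hld.isExactOn_ball
  refine ⟨fun z => g₀ z - g₀ c, by simp, fun z hz => (hg₀ z hz).sub_const _, fun z hz => ?_⟩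
  have hd : ∀ w ∈ ball c r, HasDerivAt (fun w => f w * exp (-(g₀ w - g₀ c))) 0 w := by
    intro w hw
    have h1 := (hf.differentiableAt (isOpen_ball.mem_nhds hw)).hasDerivAt
    have h2 := ((hg₀ w hw).sub_const (g₀ c)).neg.cexp
    refine (h1.mul h2).congr_deriv ?_
    have := h0 w hw
    simp only [logDeriv_apply, Pi.neg_apply]
    field_simp
    ring
  have hc : c ∈ ball c r := mem_ball_self hr
  have := (convex_ball c r).is_const_of_fderivWithin_eq_zero (𝕜 := ℂ)
    (f := fun w => f w * exp (-(g₀ w - g₀ c)))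
    (fun w hw => (hd w hw).differentiableAt.differentiableWithinAt)
    (fun w hw => by
      rw [fderivWithin_of_isOpen isOpen_ball hw]
      ext
      simpa using (hd w hw).deriv) hz hc
  simp only [sub_self, neg_zero, Complex.exp_zero, mul_one] at this
  rw [← this, mul_assoc, ← Complex.exp_add]
  simp

open Complex Metric Set in
/-- Borel-Carathéodory together with Cauchy's estimates. -/
theorem norm_iteratedDeriv_logDeriv_le {f : ℂ → ℂ} {c : ℂ} {r M : ℝ} (hr : 0 < r) (hM : 0 < M)
    (hf : DifferentiableOn ℂ f (ball c r)) (h0 : ∀ z ∈ ball c r, f z ≠ 0)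
    (hB : ∀ z ∈ ball c r, ‖f z‖ ≤ Real.exp M * ‖f c‖) (k : ℕ) :
    ‖iteratedDeriv k (logDeriv f) c‖ ≤ (k + 1).factorial * (2 * M) / (r / 2) ^ (k + 1) := by
  obtain ⟨g, hgc, hgd, hg⟩ := exists_log_of_ne_zero_on_ball hr hf h0
  have hc : c ∈ ball c r := mem_ball_self hr
  have hfc := h0 c hc
  have hre : ∀ z ∈ ball c r, (g z).re ≤ M := by
    intro z hz
    have := hB z hz
    rw [hg z hz, norm_mul, mul_comm, Complex.norm_exp] at this
    exact Real.exp_le_exp.mp (le_of_mul_le_mul_right this (norm_pos_iff.mpr hfc))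
  have hgdiff : DifferentiableOn ℂ g (ball c r) :=
    fun z hz => (hgd z hz).differentiableAt.differentiableWithinAt
  have hmaps : MapsTo (fun z : ℂ => c + z) (ball 0 r) (ball c r) := by
    intro z hz
    simpa [mem_ball, dist_eq_norm] using hz
  have hbd : ∀ z ∈ sphere c (r / 2), ‖g z‖ ≤ 2 * M := by
    intro z hz
    have hzn : ‖z - c‖ = r / 2 := by simpa [dist_eq_norm] using hz
    have := borelCaratheodory_zero (f := fun z => g (c + z)) (z := z - c) hM
      (hgdiff.comp (by fun_prop) hmaps) (fun w hw => hre _ (hmaps hw)) hr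
      (by simp [mem_ball, hzn]; linarith) (by simp [hgc])
    rw [hzn] at this
    convert this using 1
    · simp
    · field_simp; ring
  have hsub : closedBall c (r / 2) ⊆ ball c r := closedBall_subset_ball (by linarith)
  have hdc : DiffContOnCl ℂ g (ball c (r / 2)) :=
    (hgdiff.mono hsub).diffContOnCl_ball subset_rfl
  have key := norm_iteratedDeriv_le_of_forall_mem_sphere_norm_le (k + 1) (by positivity) hdc hbd
  rw [iteratedDeriv_succ'] at key
  have he : deriv g =ᶠ[nhds c] logDeriv f := by
    filter_upwards [isOpen_ball.mem_nhds hc] with z hz using (hgd z hz).deriv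
  rwa [he.iteratedDeriv_eq] at key

open Complex Metric Set in
/-- Dividing out a zero near the centre of a disc. -/
theorem exists_eq_sub_mul_of_zero {f : ℂ → ℂ} {s₀ ρ : ℂ} {R B : ℝ} (hR : 0 < R) (hB0 : 0 ≤ B)
    (hf : Differentiable ℂ f) (h0 : f s₀ ≠ 0)
    (hB : ∀ z ∈ closedBall s₀ R, ‖f z‖ ≤ B * ‖f s₀‖)
    (hρ : ρ ∈ ball s₀ (R / 3)) (hfρ : f ρ = 0) :
    ∃ g : ℂ → ℂ, Differentiable ℂ g ∧ g s₀ ≠ 0 ∧ (∀ z, f z = (z - ρ) * g z) ∧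
      (∀ z ∈ closedBall s₀ R, ‖g z‖ ≤ B / 2 * ‖g s₀‖) ∧
      logDeriv f s₀ = 1 / (s₀ - ρ) + logDeriv g s₀ := by
  have hρ' : ‖s₀ - ρ‖ < R / 3 := by rw [norm_sub_rev]; simpa [dist_eq_norm] using hρ
  have hne : s₀ - ρ ≠ 0 := by
    intro h
    rw [sub_eq_zero] at h
    exact h0 (h ▸ hfρ)
  have hfac : ∀ z, f z = (z - ρ) * dslope f ρ z := by
    intro z
    have := sub_smul_dslope f ρ z
    rw [hfρ, sub_zero, smul_eq_mul] at this
    exact this.symm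
  have hd1 : Differentiable ℂ (dslope f ρ) := by
    rw [← differentiableOn_univ]
    exact (differentiableOn_dslope Filter.univ_mem).mpr hf.differentiableOn
  have h10 : dslope f ρ s₀ ≠ 0 := by
    intro h
    exact h0 (by rw [hfac, h, mul_zero])
  refine ⟨dslope f ρ, hd1, h10, hfac, fun z hz' => ?_, ?_⟩
  · refine norm_le_of_forall_mem_frontier_norm_le (U := ball s₀ R) isBounded_ball
      hd1.diffContOnCl ?_ (by rwa [closure_ball _ hR.ne'])
    intro w hw
    rw [frontier_ball _ hR.ne'] at hw
    have hw1 := hB w (sphere_subset_closedBall hw)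
    have hwn : ‖w - s₀‖ = R := by simpa [dist_eq_norm] using hw
    have hwρ : 2 * R / 3 ≤ ‖w - ρ‖ := by
      have := norm_sub_le_norm_sub_add_norm_sub w ρ s₀
      rw [norm_sub_rev ρ s₀] at this
      linarith
    rw [hfac w, hfac s₀, norm_mul, norm_mul] at hw1
    have h3 : 0 ≤ ‖dslope f ρ s₀‖ := norm_nonneg _
    have h4 : 0 ≤ ‖dslope f ρ w‖ := norm_nonneg _
    have h5 : 2 * R / 3 * ‖dslope f ρ w‖ ≤ B * (R / 3 * ‖dslope f ρ s₀‖) := by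
      refine (mul_le_mul_of_nonneg_right hwρ h4).trans (hw1.trans ?_)
      gcongr
    have : R * ‖dslope f ρ w‖ ≤ R * (B / 2 * ‖dslope f ρ s₀‖) := by linarith
    exact le_of_mul_le_mul_left this hR
  · have : f = fun z => (z - ρ) * dslope f ρ z := funext hfac
    conv_lhs => rw [this]
    rw [logDeriv_mul s₀ hne h10 (by fun_prop) (hd1 _)]
    congr 1
    rw [logDeriv_apply]
    simp

open Complex Metric Set in
theorem neg_re_logDeriv_le_of_le_two_pow {s₀ : ℂ} {R M : ℝ} (hR : 0 < R) (hM : 0 < M) (n : ℕ) :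
    ∀ {f : ℂ → ℂ} {B : ℝ}, Differentiable ℂ f → f s₀ ≠ 0 → B ≤ Real.exp M → B < 2 ^ n →
      (∀ z ∈ closedBall s₀ R, ‖f z‖ ≤ B * ‖f s₀‖) →
      (∀ z ∈ ball s₀ (R / 3), f z = 0 → z.re ≤ s₀.re) → 
      -(logDeriv f s₀).re ≤ 12 * M / R := by
  induction n with
  | zero =>
    intro f B hf h0 hBM hB2 hB hz
    have := hB s₀ (by simp [hR.le])
    have hp := norm_pos_iff.mpr h0
    nlinarith
  | succ n ih =>
    intro f B hf h0 hBM hB2 hB hz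
    have hBpos : 0 ≤ B := by
      have := hB s₀ (by simp [hR.le])
      have hp := norm_pos_iff.mpr h0
      by_contra h
      nlinarith
    by_cases hzero : ∃ ρ ∈ ball s₀ (R / 3), f ρ = 0
    · obtain ⟨ρ, hρ, hfρ⟩ := hzero
      obtain ⟨g, hd1, h10, hfac, hb1, hl⟩ := exists_eq_sub_mul_of_zero hR hBpos hf h0 hB hρ hfρ
      have := ih hd1 h10 (by linarith) (by rw [pow_succ] at hB2; linarith) hb1
        (fun z hz1 hz2 => hz z hz1 (by rw [hfac, hz2, mul_zero]))
      have hpos : 0 ≤ (1 / (s₀ - ρ)).re := by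
        rw [one_div, inv_re]
        exact div_nonneg (by simpa using hz ρ hρ hfρ) (normSq_nonneg _)
      rw [hl, add_re]
      linarith
    · push Not at hzero
      have key := norm_iteratedDeriv_logDeriv_le (f := f) (c := s₀) (r := R / 3) (by positivity) hM
        hf.differentiableOn hzero (fun z hz => (hB z
          (ball_subset_closedBall (ball_subset_ball (by linarith) hz))).trans (by gcongr)) 0
      rw [iteratedDeriv_zero] at key
      have h1 := (abs_le.mp (abs_re_le_norm (logDeriv f s₀))).1
      have h2 : ((0 + 1 : ℕ).factorial : ℝ) * (2 * M) / (R / 3 / 2) ^ (0 + 1) = 12 * M / R := by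
        simp; field_simp; norm_num
      linarith

open Complex Metric Set in
theorem neg_re_logDeriv_le {f : ℂ → ℂ} {s₀ : ℂ} {R M : ℝ} (hR : 0 < R) (hM : 0 < M)
    (hf : Differentiable ℂ f) (h0 : f s₀ ≠ 0)
    (hB : ∀ z ∈ closedBall s₀ R, ‖f z‖ ≤ Real.exp M * ‖f s₀‖)
    (hz : ∀ z ∈ ball s₀ (R / 3), f z = 0 → z.re ≤ s₀.re) :
    -(logDeriv f s₀).re ≤ 12 * M / R := by
  obtain ⟨n, hn⟩ := pow_unbounded_of_one_lt (Real.exp M) (one_lt_two)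
  exact neg_re_logDeriv_le_of_le_two_pow hR hM n hf h0 le_rfl hn hB hz

open Complex Metric Set in
theorem neg_re_logDeriv_le_of_zero {f : ℂ → ℂ} {s₀ ρ : ℂ} {R M : ℝ} (hR : 0 < R) (hM : 0 < M)
    (hf : Differentiable ℂ f) (h0 : f s₀ ≠ 0)
    (hB : ∀ z ∈ closedBall s₀ R, ‖f z‖ ≤ Real.exp M * ‖f s₀‖)
    (hz : ∀ z ∈ ball s₀ (R / 3), f z = 0 → z.re ≤ s₀.re)
    (hρ : ρ ∈ ball s₀ (R / 3)) (hfρ : f ρ = 0) :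
    -(logDeriv f s₀).re ≤ 12 * M / R - (1 / (s₀ - ρ)).re := by
  obtain ⟨g, hd1, h10, hfac, hb1, hl⟩ :=
    exists_eq_sub_mul_of_zero hR (Real.exp_nonneg M) hf h0 hB hρ hfρ
  have := neg_re_logDeriv_le hR hM hd1 h10
    (fun z hz => (hb1 z hz).trans (by gcongr; linarith [Real.exp_pos M]))
    (fun z hz1 hz2 => hz z hz1 (by rw [hfac, hz2, mul_zero]))
  rw [hl, add_re]
  linarith

open Complex MeasureTheory Set Filter Topology in
theorem norm_integral_mul_cpow_le {b : ℝ → ℂ} {A θ : ℝ} {s : ℂ}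
    (hb : ∀ t : ℝ, 1 ≤ t → ‖b t‖ ≤ A * t ^ (1 - θ)) (hs : 1 - θ < s.re) :
    ‖∫ t in Ioi (1 : ℝ), b t * (t : ℂ) ^ (-(s + 1))‖ ≤ A / (s.re - 1 + θ) := by
  have hneg : -θ - s.re < -1 := by linarith
  have hFint := (integrableOn_Ioi_rpow_of_lt hneg zero_lt_one).const_mul A
  refine (norm_integral_le_of_norm_le hFint ?_).trans ?_
  · refine (ae_restrict_iff' measurableSet_Ioi).mpr (Eventually.of_forall fun t ht => ?_)
    have ht0 : (0 : ℝ) < t := zero_lt_one.trans ht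
    rw [norm_mul, norm_cpow_eq_rpow_re_of_pos ht0]
    refine (mul_le_mul_of_nonneg_right (hb t (le_of_lt ht)) (by positivity)).trans ?_
    rw [mul_assoc, ← Real.rpow_add ht0]
    simp only [neg_add_rev, add_re, neg_re, one_re]
    ring_nf
    rfl
  · rw [integral_const_mul, integral_Ioi_rpow_of_lt hneg zero_lt_one]
    simp only [Real.one_rpow]
    have h : s.re - 1 + θ ≠ 0 := by linarith
    have h2 : -θ - s.re + 1 ≠ 0 := by intro h'; apply h; linarith
    apply le_of_eq
    field_simp
    ring

open Complex MeasureTheory Set Filter Topology Asymptotics in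
theorem differentiableAt_integral_mul_cpow {b : ℝ → ℂ} {A : ℝ} (hbm : Measurable b)
    (hb : ∀ t : ℝ, 1 ≤ t → ‖b t‖ ≤ A) {s : ℂ} (hs : 0 < s.re) :
    DifferentiableAt ℂ (fun s : ℂ => ∫ t in Ioi (1 : ℝ), b t * (t : ℂ) ^ (-(s + 1))) s := by
  have hA : 0 ≤ A := (norm_nonneg _).trans (hb 1 le_rfl)
  set f : ℝ → ℂ := indicator (Ioi 1) b with hf
  have hfb : ∀ t, ‖f t‖ ≤ A := by
    intro t
    by_cases h : t ∈ Ioi (1 : ℝ)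
    · rw [hf, indicator_of_mem h]; exact hb t (le_of_lt h)
    · rw [hf, indicator_of_notMem h]; simpa using hA
  have hfm : Measurable f := hbm.indicator measurableSet_Ioi
  have hloc : LocallyIntegrable f volume := by
    refine (locallyIntegrable_const A).mono hfm.aestronglyMeasurable ?_
    exact Eventually.of_forall fun t => by simpa [abs_of_nonneg hA] using hfb t
  have hm : DifferentiableAt ℂ (mellin f) (-s) := by
    refine mellin_differentiableAt_of_isBigO_rpow (a := 0) (b := -s.re - 1)
      (hloc.locallyIntegrableOn _) ?_ (by simpa using hs) ?_ (by simp)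
    · refine IsBigO.of_bound A (Eventually.of_forall fun t => ?_)
      simpa using hfb t
    · refine IsBigO.of_bound 0 ?_
      filter_upwards [Ioo_mem_nhdsGT (zero_lt_one (α := ℝ))] with t ht
      rw [hf, indicator_of_notMem (by simpa using ht.2.le)]
      simp
  have heq : (fun s : ℂ => ∫ t in Ioi (1 : ℝ), b t * (t : ℂ) ^ (-(s + 1))) =
      fun s => mellin f (-s) := by
    ext z
    rw [mellin, ← integral_indicator measurableSet_Ioi, ← integral_indicator measurableSet_Ioi]
    congr 1
    ext t
    by_cases h : t ∈ Ioi (1 : ℝ)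
    · have h0 : t ∈ Ioi (0 : ℝ) := mem_Ioi.mpr (zero_lt_one.trans h)
      rw [indicator_of_mem h, indicator_of_mem h0, hf, indicator_of_mem h, smul_eq_mul, mul_comm]
      congr 2
      ring
    · rw [indicator_of_notMem h]
      symm
      rw [indicator_apply_eq_zero]
      intro _
      rw [hf, indicator_of_notMem h, smul_zero]
  rw [heq]
  exact hm.comp s differentiable_neg.differentiableAt

open Complex Set Topology Filter in
theorem eqOn_re_pos_of_eqOn_one_lt_re {f g : ℂ → ℂ} (hf : ∀ s : ℂ, 0 < s.re → DifferentiableAt ℂ f s)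
    (hg : ∀ s : ℂ, 0 < s.re → DifferentiableAt ℂ g s) (h : ∀ s : ℂ, 1 < s.re → f s = g s) {s : ℂ}
    (hs : 0 < s.re) : f s = g s := by
  have hopen : IsOpen {z : ℂ | 0 < z.re} := isOpen_lt continuous_const continuous_re
  have hpre : IsPreconnected {z : ℂ | 0 < z.re} := (convex_halfSpace_re_gt 0).isPreconnected
  have hfa : AnalyticOnNhd ℂ f {z : ℂ | 0 < z.re} :=
    DifferentiableOn.analyticOnNhd (fun z hz => (hf z hz).differentiableWithinAt) hopen
  have hga : AnalyticOnNhd ℂ g {z : ℂ | 0 < z.re} :=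
    DifferentiableOn.analyticOnNhd (fun z hz => (hg z hz).differentiableWithinAt) hopen
  refine hfa.eqOn_of_preconnected_of_eventuallyEq hga hpre (z₀ := 2) (by simp) ?_ hs
  have : {z : ℂ | 1 < z.re} ∈ 𝓝 (2 : ℂ) :=
    (isOpen_lt continuous_const continuous_re).mem_nhds (by simp)
  filter_upwards [this] with z hz using h z hz

namespace DirichletCharacter

variable {q : ℕ} [NeZero q]

theorem sum_range_add_mod {χ : DirichletCharacter ℂ q} (hχ : χ ≠ 1) (m : ℕ) :
    ∑ k ∈ Finset.range (q * m), χ (k : ZMod q) = 0 := by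
  induction m with
  | zero => simp
  | succ m ih =>
    rw [Nat.mul_succ, Finset.sum_range_add, ih, zero_add]
    have : ∀ i, χ ((q * m + i : ℕ) : ZMod q) = χ (i : ZMod q) := by simp
    simp only [this]
    rw [← MulChar.sum_eq_zero_of_ne_one hχ, Finset.sum_range]
    obtain ⟨n, rfl⟩ : ∃ n, q = n + 1 := ⟨q - 1, (Nat.succ_pred_eq_of_pos (NeZero.pos q)).symm⟩
    refine Fintype.sum_congr _ _ fun i => ?_
    congr 1
    exact Fin.cast_val_eq_self i

omit [NeZero q] in
theorem norm_sum_Icc_le (χ : DirichletCharacter ℂ q) (n : ℕ) :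
    ‖∑ k ∈ Finset.Icc 1 n, χ (k : ZMod q)‖ ≤ n := by
  refine (norm_sum_le _ _).trans ((Finset.sum_le_sum fun k _ => χ.norm_le_one _).trans ?_)
  simp

theorem norm_sum_Icc_le_modulus {χ : DirichletCharacter ℂ q} (hχ : χ ≠ 1) (n : ℕ) :
    ‖∑ k ∈ Finset.Icc 1 n, χ (k : ZMod q)‖ ≤ q := by
  have h0 : χ (0 : ZMod q) = 0 := by
    apply χ.map_nonunit
    intro h
    apply hχ
    have hq : Subsingleton (ZMod q) := subsingleton_of_zero_eq_one (isUnit_zero_iff.mp h)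
    ext a
    rw [Subsingleton.elim (a : ZMod q) 1]
    simp
  have h1 : ∑ k ∈ Finset.Icc 1 n, χ (k : ZMod q) = ∑ k ∈ Finset.range (n + 1), χ (k : ZMod q) := by
    rw [Finset.range_eq_Ico, Finset.sum_eq_sum_Ico_succ_bot (Nat.succ_pos n), Nat.cast_zero, h0, zero_add]
    rfl
  rw [h1, ← Nat.div_add_mod (n + 1) q, Finset.sum_range_add, sum_range_add_mod hχ, zero_add]
  refine (norm_sum_le _ _).trans ((Finset.sum_le_sum fun k _ => χ.norm_le_one _).trans ?_)
  simpa using (Nat.mod_lt _ (NeZero.pos q)).le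

open Complex MeasureTheory Set Filter Topology Asymptotics in
theorem LFunction_eq_mul_integral {χ : DirichletCharacter ℂ q} (hχ : χ ≠ 1) {s : ℂ} (hs : 0 < s.re) :
    LFunction χ s = s * ∫ t in Ioi (1 : ℝ), (∑ k ∈ Finset.Icc 1 ⌊t⌋₊, χ (k : ZMod q)) *
      (t : ℂ) ^ (-(s + 1)) := by
  have hm : Measurable fun t : ℝ => ∑ k ∈ Finset.Icc 1 ⌊t⌋₊, χ (k : ZMod q) :=
    (measurable_from_nat (f := fun n => ∑ k ∈ Finset.Icc 1 n, χ (k : ZMod q))).comp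
      Nat.measurable_floor
  refine eqOn_re_pos_of_eqOn_one_lt_re (fun s _ => differentiable_LFunction hχ s)
    (g := fun s => s * ∫ t in Ioi (1 : ℝ), (∑ k ∈ Finset.Icc 1 ⌊t⌋₊, χ (k : ZMod q)) *
      (t : ℂ) ^ (-(s + 1)))
    (fun s hs => differentiableAt_id.mul (differentiableAt_integral_mul_cpow hm (A := q)
      (fun t _ => norm_sum_Icc_le_modulus hχ _) hs)) (fun s hs => ?_) hs
  rw [LFunction_eq_LSeries χ hs]
  refine LSeries_eq_mul_integral _ zero_le_one hs (LSeriesSummable_of_one_lt_re χ hs) ?_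
  refine IsBigO.of_bound 1 (Eventually.of_forall fun n => ?_)
  simpa using norm_sum_Icc_le χ n

open Complex in
theorem norm_LFunction_le {χ : DirichletCharacter ℂ q} (hχ : χ ≠ 1) {s : ℂ} {θ : ℝ} (hθ0 : 0 ≤ θ)
    (hθ1 : θ ≤ 1) (hs : 1 - θ < s.re) :
    ‖LFunction χ s‖ ≤ ‖s‖ * ((q : ℝ) ^ θ / (s.re - 1 + θ)) := by
  rw [LFunction_eq_mul_integral hχ (by linarith), norm_mul]
  gcongr
  refine norm_integral_mul_cpow_le (fun t ht => ?_) hs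
  have h1 : ‖∑ k ∈ Finset.Icc 1 ⌊t⌋₊, χ (k : ZMod q)‖ ≤ t :=
    (norm_sum_Icc_le χ _).trans (Nat.floor_le (by linarith))
  have h2 := norm_sum_Icc_le_modulus hχ ⌊t⌋₊
  set x := ‖∑ k ∈ Finset.Icc 1 ⌊t⌋₊, χ (k : ZMod q)‖ with hx
  have hx0 : 0 ≤ x := norm_nonneg _
  calc x = x ^ (θ + (1 - θ)) := by simp
    _ = x ^ θ * x ^ (1 - θ) := Real.rpow_add_of_nonneg hx0 hθ0 (by linarith)
    _ ≤ _ := by gcongr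

theorem conj_apply_of_sq_eq_one {χ : DirichletCharacter ℂ q} (hχ : χ ^ 2 = 1) (a : ZMod q) :
    (starRingEnd ℂ) (χ a) = χ a := by
  by_cases ha : IsUnit a
  · have h : χ a ^ 2 = 1 := by
      rw [← MulChar.pow_apply' χ two_ne_zero, hχ, MulChar.one_apply ha]
    rw [sq] at h
    rcases mul_self_eq_one_iff.mp h with h | h <;> simp [h]
  · simp [χ.map_nonunit ha]

open MeasureTheory Set in
theorem LFunction_ofReal_im {χ : DirichletCharacter ℂ q} (hχ : χ ≠ 1) (hχ2 : χ ^ 2 = 1) {σ : ℝ}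
    (hσ : 0 < σ) : (LFunction χ σ).im = 0 := by
  rw [← Complex.conj_eq_iff_im, LFunction_eq_mul_integral hχ (by simpa using hσ), map_mul,
    Complex.conj_ofReal, ← integral_conj]
  congr 1
  refine setIntegral_congr_fun measurableSet_Ioi fun t ht => ?_
  have ht0 : (0 : ℝ) ≤ t := zero_le_one.trans (le_of_lt ht)
  simp only [map_mul, map_sum, conj_apply_of_sq_eq_one hχ2]
  congr 1
  rw [← Complex.ofReal_one, ← Complex.ofReal_add, ← Complex.ofReal_neg, ← Complex.ofReal_cpow ht0,
    Complex.conj_ofReal]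

end DirichletCharacter

open Complex MeasureTheory Set Filter Topology Asymptotics in
theorem riemannZeta₀_eq_integral {s : ℂ} (hs : 0 < s.re) :
    riemannZeta₀ s = 1 - s * ∫ t in Ioi (1 : ℝ), ((Int.fract t : ℝ) : ℂ) * (t : ℂ) ^ (-(s + 1)) := by
  have hb : ∀ t : ℝ, 1 ≤ t → ‖((Int.fract t : ℝ) : ℂ)‖ ≤ 1 := fun t _ => by
    rw [norm_real, Real.norm_of_nonneg (Int.fract_nonneg t)]
    exact (Int.fract_lt_one t).le
  have hm : Measurable fun t : ℝ => ((Int.fract t : ℝ) : ℂ) := by fun_prop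
  refine eqOn_re_pos_of_eqOn_one_lt_re (fun s _ => differentiable_riemannZeta₀ s)
    (g := fun s => 1 - s * ∫ t in Ioi (1 : ℝ), ((Int.fract t : ℝ) : ℂ) * (t : ℂ) ^ (-(s + 1)))
    (fun s hs => (differentiableAt_const _).sub
      (differentiableAt_id.mul (differentiableAt_integral_mul_cpow hm hb hs))) (fun s hs => ?_) hs
  have hs1 : s ≠ 1 := by rintro rfl; simp at hs
  have hs1' : s - 1 ≠ 0 := sub_ne_zero_of_ne hs1
  have h1 : riemannZeta s = s * ∫ t in Ioi (1 : ℝ), ((⌊t⌋₊ : ℂ)) * (t : ℂ) ^ (-(s + 1)) := by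
    rw [← LSeries_one_eq_riemannZeta hs, LSeries_eq_mul_integral 1 zero_le_one hs
      (LSeriesSummable_one_iff.mpr hs)]
    · simp
    · refine IsBigO.of_bound 1 (Eventually.of_forall fun n => ?_)
      simp
  have hre : (-s).re < -1 := by simpa using hs
  have hre' : (-(s + 1)).re < -1 := by simp; linarith
  have i1 : IntegrableOn (fun t : ℝ => (t : ℂ) ^ (-s)) (Ioi 1) :=
    integrableOn_Ioi_cpow_of_lt hre zero_lt_one
  have i2 : IntegrableOn (fun t : ℝ => ((Int.fract t : ℝ) : ℂ) * (t : ℂ) ^ (-(s + 1))) (Ioi 1) :=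
    (integrableOn_Ioi_cpow_of_lt hre' zero_lt_one).bdd_mul (c := 1) hm.aestronglyMeasurable
      (Eventually.of_forall fun t => by
        rw [norm_real, Real.norm_of_nonneg (Int.fract_nonneg t)]
        exact (Int.fract_lt_one t).le)
  have h2 : ∫ t in Ioi (1 : ℝ), ((⌊t⌋₊ : ℂ)) * (t : ℂ) ^ (-(s + 1)) =
      (∫ t in Ioi (1 : ℝ), (t : ℂ) ^ (-s)) -
        ∫ t in Ioi (1 : ℝ), ((Int.fract t : ℝ) : ℂ) * (t : ℂ) ^ (-(s + 1)) := by
    rw [← integral_sub i1 i2]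
    refine setIntegral_congr_fun measurableSet_Ioi fun t ht => ?_
    have ht0 : (0 : ℝ) < t := zero_lt_one.trans ht
    have e1 : (t : ℂ) ^ (-s) = t * (t : ℂ) ^ (-(s + 1)) := by
      rw [show (-s) = 1 + (-(s + 1)) by ring, cpow_add _ _ (ofReal_ne_zero.mpr ht0.ne'), cpow_one]
    have e2 : ((Int.fract t : ℝ) : ℂ) = t - (⌊t⌋₊ : ℂ) := by
      rw [← Int.self_sub_floor, ← natCast_floor_eq_intCast_floor ht0.le]
      push_cast
      rfl
    simp only [e1, e2]
    ring
  rw [riemannZeta₀, if_neg hs1, h1, h2, integral_Ioi_cpow_of_lt hre zero_lt_one]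
  simp only [ofReal_one, one_cpow]
  have : -s + 1 ≠ 0 := by intro h; apply hs1'; linear_combination -h
  field_simp
  ring

theorem norm_riemannZeta₀_le {s : ℂ} (hs : 0 < s.re) : ‖riemannZeta₀ s‖ ≤ 1 + ‖s‖ / s.re := by
  rw [riemannZeta₀_eq_integral hs]
  refine (norm_sub_le _ _).trans ?_
  rw [norm_one, norm_mul, div_eq_mul_one_div]
  gcongr
  refine (norm_integral_mul_cpow_le (A := 1) (θ := 1) (fun t _ => ?_) (by simpa using hs)).trans ?_
  · rw [Complex.norm_real, Real.norm_of_nonneg (Int.fract_nonneg t)]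
    simpa using (Int.fract_lt_one t).le
  · simp

theorem norm_riemannZeta₁_le {s : ℂ} (hs : 0 < s.re) :
    ‖riemannZeta₁ s‖ ≤ 1 + ‖s - 1‖ * (1 + ‖s‖ / s.re) := by
  rw [riemannZeta₁]
  refine (norm_add_le _ _).trans ?_
  rw [norm_one, norm_mul]
  gcongr
  exact norm_riemannZeta₀_le hs

open MeasureTheory Set in
theorem exists_riemannZeta₀_ofReal {σ : ℝ} (hσ : 0 < σ) : ∃ x : ℝ, x ≤ 1 ∧ riemannZeta₀ σ = x := by
  refine ⟨1 - σ * ∫ t in Ioi (1 : ℝ), Int.fract t * t ^ (-(σ + 1)), ?_, ?_⟩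
  · have : 0 ≤ ∫ t in Ioi (1 : ℝ), Int.fract t * t ^ (-(σ + 1)) := by
      refine setIntegral_nonneg measurableSet_Ioi fun t ht => ?_
      have ht0 : (0 : ℝ) < t := zero_lt_one.trans ht
      have := Int.fract_nonneg t
      positivity
    nlinarith
  · rw [riemannZeta₀_eq_integral (by simpa using hσ)]
    push_cast
    congr 2
    rw [← integral_complex_ofReal]
    refine setIntegral_congr_fun measurableSet_Ioi fun t ht => ?_
    have ht0 : (0 : ℝ) ≤ t := zero_le_one.trans (le_of_lt ht)
    push_cast
    rw [Complex.ofReal_cpow ht0]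
    push_cast
    rfl

theorem exists_riemannZeta_ofReal {σ : ℝ} (hσ : 0 < σ) (hσ1 : σ ≠ 1) :
    ∃ x : ℝ, x ≤ σ / (σ - 1) ∧ riemannZeta σ = x := by
  obtain ⟨x, hx, hx'⟩ := exists_riemannZeta₀_ofReal hσ
  have h : σ - 1 ≠ 0 := sub_ne_zero_of_ne hσ1
  refine ⟨(σ - 1)⁻¹ + x, ?_, ?_⟩
  · have : σ / (σ - 1) = (σ - 1)⁻¹ + 1 := by field_simp; ring
    rw [this]; gcongr
  · rw [riemannZeta_eq_inv_sub_add (by exact_mod_cast hσ1), hx']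
    push_cast
    rfl

open Complex in
theorem norm_term_le_re_term_one {f : ℕ → ℂ} (hf : ∀ n, ‖f n‖ ≤ 1) (s : ℂ) (n : ℕ) :
    ‖LSeries.term f s n‖ ≤ (LSeries.term 1 (s.re : ℂ) n).re := by
  rcases eq_or_ne n 0 with rfl | hn
  · simp
  · have hn' : 0 < n := Nat.pos_of_ne_zero hn
    rw [LSeries.norm_term_eq, if_neg hn, LSeries.term_of_ne_zero hn, Pi.one_apply,
      ← ofReal_natCast, ← ofReal_cpow (Nat.cast_nonneg n), ← ofReal_one, ← ofReal_div, ofReal_re]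
    gcongr
    exact hf n

open Complex in
theorem norm_LSeries_le {f : ℕ → ℂ} (hf : ∀ n, ‖f n‖ ≤ 1) {s : ℂ} (hs : 1 < s.re) :
    ‖LSeries f s‖ ≤ s.re / (s.re - 1) := by
  have h1 : LSeriesSummable 1 (s.re : ℂ) := LSeriesSummable_one_iff.mpr (by simpa using hs)
  obtain ⟨x, hx, hx'⟩ := exists_riemannZeta_ofReal (zero_lt_one.trans hs) hs.ne'
  have h2 : HasSum (fun n => (LSeries.term 1 (s.re : ℂ) n).re) x := by
    have := hasSum_re h1.hasSum
    have h3 : ∑' n, LSeries.term 1 (s.re : ℂ) n = x := by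
      rw [← hx', ← LSeries_one_eq_riemannZeta (by simpa using hs)]
      rfl
    rwa [h3, ofReal_re] at this
  refine le_trans ?_ hx
  exact tsum_of_norm_bounded h2 (norm_term_le_re_term_one hf s)

namespace DirichletCharacter

variable {q : ℕ} [NeZero q]

open ArithmeticFunction in
theorem le_norm_LFunction (χ : DirichletCharacter ℂ q) {s : ℂ} (hs : 1 < s.re) :
    (s.re - 1) / s.re ≤ ‖LFunction χ s‖ := by
  have h1 := LSeries.mul_mu_eq_one χ hs
  rw [← LFunction_eq_LSeries χ hs] at h1
  have h2 : ‖LSeries ((fun n : ℕ => (χ n : ℂ)) * fun n => ((ArithmeticFunction.moebius n : ℤ) : ℂ)) s‖ ≤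
      s.re / (s.re - 1) := by
    refine norm_LSeries_le (fun n => ?_) hs
    rw [Pi.mul_apply, norm_mul]
    refine mul_le_one₀ (χ.norm_le_one _) (norm_nonneg _) ?_
    rw [Complex.norm_intCast]
    exact_mod_cast ArithmeticFunction.abs_moebius_le_one
  have h3 := congrArg norm h1
  rw [norm_mul, norm_one] at h3
  have h4 : 0 < s.re / (s.re - 1) := div_pos (by linarith) (by linarith)
  have h5 : 0 < ‖LFunction χ s‖ := by
    rw [norm_pos_iff]
    intro h
    simp [h] at h3
  rw [← inv_div, inv_le_comm₀ h4 h5]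
  refine le_trans (le_of_eq ?_) h2
  field_simp
  linarith

end DirichletCharacter

theorem le_norm_riemannZeta {s : ℂ} (hs : 1 < s.re) : (s.re - 1) / s.re ≤ ‖riemannZeta s‖ := by
  have := DirichletCharacter.le_norm_LFunction (1 : DirichletCharacter ℂ 1) hs
  rwa [DirichletCharacter.LFunction_modOne_eq] at this

open Complex Metric in
theorem norm_riemannZeta₁_le_exp_mul {η t : ℝ} (hη : 0 < η) (hη1 : η ≤ 1) {z : ℂ}
    (hz : z ∈ closedBall (1 + η + t * I) (1 / 2)) :
    ‖riemannZeta₁ z‖ ≤ Real.exp (2 * Real.log (8 * (|t| + 3) / η)) *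
      ‖riemannZeta₁ (1 + η + t * I)‖ := by
  have ht := abs_nonneg t
  rw [mem_closedBall, dist_eq] at hz
  have hre : 1 / 2 ≤ z.re := by
    have := (abs_le.mp ((abs_re_le_norm (z - (1 + η + t * I))).trans hz)).1
    simp at this
    linarith
  have hz1 : ‖z - 1‖ ≤ |t| + 2 := by
    calc ‖z - 1‖ = ‖(z - (1 + η + t * I)) + (η + t * I)‖ := by congr 1; ring
      _ ≤ ‖z - (1 + η + t * I)‖ + (‖(η : ℂ)‖ + ‖(t : ℂ) * I‖) :=
        (norm_add_le _ _).trans (by gcongr; exact norm_add_le _ _)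
      _ ≤ 1 / 2 + (η + |t|) := by
        gcongr
        · rw [norm_real, Real.norm_of_nonneg hη.le]
        · simp
      _ ≤ _ := by linarith
  have hz2 : ‖z‖ ≤ |t| + 3 := by
    calc ‖z‖ = ‖(z - 1) + 1‖ := by simp
      _ ≤ ‖z - 1‖ + ‖(1 : ℂ)‖ := norm_add_le _ _
      _ ≤ _ := by rw [norm_one]; linarith
  have h1 : ‖riemannZeta₁ z‖ ≤ 4 * (|t| + 3) ^ 2 := by
    refine (norm_riemannZeta₁_le (by linarith)).trans ?_
    have : ‖z‖ / z.re ≤ 2 * (|t| + 3) := by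
      rw [div_le_iff₀ (by linarith)]
      nlinarith
    have : ‖z - 1‖ * (1 + ‖z‖ / z.re) ≤ (|t| + 2) * (1 + 2 * (|t| + 3)) := by
      gcongr
    nlinarith
  have hs : (1 : ℂ) + η + t * I ≠ 1 := by
    intro h
    have := congrArg re h
    simp at this
    linarith
  have hlow : η ^ 2 / 2 ≤ ‖riemannZeta₁ (1 + η + t * I)‖ := by
    have e : riemannZeta₁ (1 + η + t * I) = (η + t * I) * riemannZeta (1 + η + t * I) := by
      rw [riemannZeta_eq_inv_sub_mul hs, ← mul_assoc, show (1 : ℂ) + η + t * I - 1 = η + t * I by ring,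
        mul_inv_cancel₀, one_mul]
      intro h
      apply hs
      linear_combination h
    rw [e, norm_mul]
    have h2 := le_norm_riemannZeta (s := 1 + η + t * I) (by simpa using hη)
    have h3 : η ≤ ‖(η : ℂ) + t * I‖ := by
      refine le_trans ?_ (re_le_norm _)
      simp
    have h4 : η / 2 ≤ (1 + η - 1) / (1 + η) := by
      rw [add_sub_cancel_left]
      gcongr
      linarith
    simp only [add_re, one_re, ofReal_re, mul_re, I_re, mul_zero, ofReal_im, I_im, mul_one,
      sub_self, add_zero] at h2
    calc η ^ 2 / 2 = η * (η / 2) := by ring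
      _ ≤ _ := by
        gcongr
        exact h4.trans h2
  refine h1.trans ?_
  rw [two_mul, Real.exp_add, Real.exp_log (by positivity)]
  refine le_trans ?_ (mul_le_mul_of_nonneg_left hlow (by positivity))
  have : 8 * (|t| + 3) / η * (8 * (|t| + 3) / η) * (η ^ 2 / 2) = 32 * (|t| + 3) ^ 2 := by
    field_simp
    norm_num
  rw [this]
  nlinarith

open Complex Metric in
theorem DirichletCharacter.norm_LFunction_le_exp_mul {q : ℕ} [NeZero q] {χ : DirichletCharacter ℂ q}
    (hχ : χ ≠ 1) {η t : ℝ} (hη : 0 < η) (hη1 : η ≤ 1) {z : ℂ}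
    (hz : z ∈ closedBall (1 + η + t * I) (1 / 2)) :
    ‖LFunction χ z‖ ≤ Real.exp (Real.log (8 * q * (|t| + 3) / η)) *
      ‖LFunction χ (1 + η + t * I)‖ := by
  have ht := abs_nonneg t
  have hq : (1 : ℝ) ≤ q := by exact_mod_cast NeZero.one_le
  rw [mem_closedBall, dist_eq] at hz
  have hre : 1 / 2 ≤ z.re := by
    have := (abs_le.mp ((abs_re_le_norm (z - (1 + η + t * I))).trans hz)).1
    simp at this
    linarith
  have hz2 : ‖z‖ ≤ |t| + 3 := by
    calc ‖z‖ = ‖(z - (1 + η + t * I)) + (1 + η + t * I)‖ := by congr 1; ring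
      _ ≤ ‖z - (1 + η + t * I)‖ + (‖(1 : ℂ)‖ + ‖(η : ℂ)‖ + ‖(t : ℂ) * I‖) :=
        (norm_add_le _ _).trans (by gcongr; exact norm_add₃_le)
      _ ≤ 1 / 2 + (1 + η + |t|) := by
        gcongr
        · simp
        · rw [norm_real, Real.norm_of_nonneg hη.le]
        · simp
      _ ≤ _ := by linarith
  have h1 : ‖LFunction χ z‖ ≤ (|t| + 3) * (q / (1 / 2)) := by
    refine (norm_LFunction_le hχ zero_le_one le_rfl (by linarith)).trans ?_
    have hre' : (1 / 2 : ℝ) ≤ z.re - 1 + 1 := by linarith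
    rw [Real.rpow_one]
    exact mul_le_mul hz2 (by gcongr) (by positivity) (by linarith)
  have hlow : η / 2 ≤ ‖LFunction χ (1 + η + t * I)‖ := by
    have h2 := le_norm_LFunction χ (s := 1 + η + t * I) (by simpa using hη)
    simp only [add_re, one_re, ofReal_re, mul_re, I_re, mul_zero, ofReal_im, I_im, mul_one,
      sub_self, add_zero] at h2
    refine le_trans ?_ h2
    rw [add_sub_cancel_left]
    gcongr
    linarith
  refine h1.trans ?_
  rw [Real.exp_log (by positivity)]
  refine le_trans ?_ (mul_le_mul_of_nonneg_left hlow (by positivity))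
  have : 8 * q * (|t| + 3) / η * (η / 2) = 4 * (q * (|t| + 3)) := by
    field_simp
    norm_num
  rw [this]
  nlinarith [mul_nonneg (by linarith : (0 : ℝ) ≤ q) (by linarith : (0 : ℝ) ≤ |t| + 3)]

theorem three_add_four_mul_re_add_re_nonneg {a b : ℂ} (hb : ‖b‖ ≤ 1)
    (h : a = 0 ∨ (‖a‖ = 1 ∧ b = a ^ 2)) : 0 ≤ 3 + 4 * a.re + b.re := by
  rcases h with rfl | ⟨ha, rfl⟩
  · have := (abs_le.mp ((Complex.abs_re_le_norm b).trans hb)).1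
    simp only [Complex.zero_re]
    linarith
  · have h1 : a.re ^ 2 + a.im ^ 2 = 1 := by
      have := Complex.sq_norm a
      rw [ha, Complex.normSq_apply] at this
      linarith
    simp only [sq, Complex.mul_re]
    nlinarith [sq_nonneg (a.re + 1)]

open Complex in
theorem norm_natCast_cpow_neg_mul_I {n : ℕ} (hn : n ≠ 0) (t : ℝ) : ‖(n : ℂ) ^ (-(t * I))‖ = 1 := by
  rw [norm_natCast_cpow_of_pos (Nat.pos_of_ne_zero hn)]
  simp

open Complex ArithmeticFunction in
theorem three_four_one_term {f g : ℕ → ℂ} (hg : ∀ n, ‖g n‖ ≤ 1)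
    (h : ∀ n, f n = 0 ∨ (‖f n‖ = 1 ∧ g n = f n ^ 2)) {σ : ℝ} (t : ℝ) (n : ℕ) :
    0 ≤ 3 * (LSeries.term (fun n : ℕ => (ArithmeticFunction.vonMangoldt n : ℂ)) σ n).re +
      4 * (LSeries.term (f * (fun n : ℕ => (ArithmeticFunction.vonMangoldt n : ℂ))) (σ + t * I) n).re +
      (LSeries.term (g * (fun n : ℕ => (ArithmeticFunction.vonMangoldt n : ℂ))) (σ + 2 * t * I) n).re := by
  rcases eq_or_ne n 0 with rfl | hn
  · simp
  set a : ℂ := f n * (n : ℂ) ^ (-(t * I)) with ha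
  set b : ℂ := g n * (n : ℂ) ^ (-((2 * t : ℝ) * I)) with hb
  have hn0 : (n : ℂ) ≠ 0 := Nat.cast_ne_zero.mpr hn
  have hab : a = 0 ∨ (‖a‖ = 1 ∧ b = a ^ 2) := by
    rcases h n with h | ⟨h1, h2⟩
    · left; rw [ha, h, zero_mul]
    · right
      refine ⟨by rw [ha, norm_mul, h1, norm_natCast_cpow_neg_mul_I hn, one_mul], ?_⟩
      rw [hb, ha, h2, mul_pow, ← cpow_nat_mul]
      congr 2
      push_cast
      ring
  have hb1 : ‖b‖ ≤ 1 := by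
    rw [hb, norm_mul, norm_natCast_cpow_neg_mul_I hn, mul_one]
    exact hg n
  set w : ℝ := ArithmeticFunction.vonMangoldt n / (n : ℝ) ^ σ with hw
  have hw0 : 0 ≤ w := div_nonneg ArithmeticFunction.vonMangoldt_nonneg (by positivity)
  have hwc : (w : ℂ) = ArithmeticFunction.vonMangoldt n / (n : ℂ) ^ (σ : ℂ) := by
    rw [hw, ofReal_div, ofReal_cpow (Nat.cast_nonneg n), ofReal_natCast]
  have e1 : LSeries.term (fun n : ℕ => (ArithmeticFunction.vonMangoldt n : ℂ)) σ n = w := by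
    rw [LSeries.term_of_ne_zero hn, hwc]
  have e2 : LSeries.term (f * (fun n : ℕ => (ArithmeticFunction.vonMangoldt n : ℂ))) (σ + t * I) n = w * a := by
    rw [LSeries.term_of_ne_zero hn, hwc, ha, cpow_add _ _ hn0, cpow_neg, Pi.mul_apply]
    field_simp
  have e3 : LSeries.term (g * (fun n : ℕ => (ArithmeticFunction.vonMangoldt n : ℂ))) (σ + 2 * t * I) n = w * b := by
    rw [LSeries.term_of_ne_zero hn, hwc, hb, cpow_add _ _ hn0, cpow_neg, Pi.mul_apply]
    push_cast
    field_simp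
  rw [e1, e2, e3, re_ofReal_mul, re_ofReal_mul, ofReal_re]
  have := mul_nonneg hw0 (three_add_four_mul_re_add_re_nonneg hb1 hab)
  linarith

open Complex ArithmeticFunction in
theorem LSeriesSummable_mul_vonMangoldt {f : ℕ → ℂ} (hf : ∀ n, ‖f n‖ ≤ 1) {s : ℂ} (hs : 1 < s.re) :
    LSeriesSummable (f * (fun n : ℕ => (ArithmeticFunction.vonMangoldt n : ℂ))) s := by
  refine (ArithmeticFunction.LSeriesSummable_vonMangoldt hs).norm.of_norm_bounded fun n => ?_
  refine LSeries.norm_term_le s ?_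
  rw [Pi.mul_apply, norm_mul]
  exact mul_le_of_le_one_left (norm_nonneg _) (hf n)

open Complex ArithmeticFunction in
theorem three_four_one_LSeries {f g : ℕ → ℂ} (hg : ∀ n, ‖g n‖ ≤ 1)
    (h : ∀ n, f n = 0 ∨ (‖f n‖ = 1 ∧ g n = f n ^ 2)) {σ : ℝ} (hσ : 1 < σ) (t : ℝ) :
    0 ≤ 3 * (LSeries (fun n : ℕ => (ArithmeticFunction.vonMangoldt n : ℂ)) σ).re +
      4 * (LSeries (f * (fun n : ℕ => (ArithmeticFunction.vonMangoldt n : ℂ))) (σ + t * I)).re +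
      (LSeries (g * (fun n : ℕ => (ArithmeticFunction.vonMangoldt n : ℂ))) (σ + 2 * t * I)).re := by
  have hf : ∀ n, ‖f n‖ ≤ 1 := fun n => by
    rcases h n with h | h
    · simp [h]
    · exact h.1.le
  have s1 := ArithmeticFunction.LSeriesSummable_vonMangoldt (s := σ) (by simpa using hσ)
  have s2 := LSeriesSummable_mul_vonMangoldt hf (s := σ + t * I) (by simpa using hσ)
  have s3 := LSeriesSummable_mul_vonMangoldt hg (s := σ + 2 * t * I) (by simpa using hσ)
  have h1 := (((hasSum_re s1.hasSum).mul_left 3).add ((hasSum_re s2.hasSum).mul_left 4)).add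
    (hasSum_re s3.hasSum)
  exact h1.nonneg fun n => three_four_one_term hg h t n

theorem logDeriv_riemannZeta₁ {s : ℂ} (hs : 1 < s.re) :
    logDeriv riemannZeta₁ s = 1 / (s - 1) + deriv riemannZeta s / riemannZeta s := by
  have hs1 : s ≠ 1 := by rintro rfl; simp at hs
  have hs2 : s - 1 ≠ 0 := sub_ne_zero_of_ne hs1
  have hz := riemannZeta_ne_zero_of_one_lt_re hs
  have hz1 : riemannZeta₁ s ≠ 0 := by
    intro h
    rw [riemannZeta_eq_inv_sub_mul hs1, h, mul_zero] at hz
    exact hz rfl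
  rw [logDeriv_apply, deriv_riemannZeta_eq_neg_inv_sub_sq_mul_add hs1,
    riemannZeta_eq_inv_sub_mul hs1]
  field_simp
  ring

theorem riemannZeta₁_ne_zero_of_one_le_re {s : ℂ} (hs : 1 ≤ s.re) : riemannZeta₁ s ≠ 0 := by
  rcases eq_or_ne s 1 with rfl | hs1
  · simp
  · intro h
    apply riemannZeta_ne_zero_of_one_le_re hs
    rw [riemannZeta_eq_inv_sub_mul hs1, h, mul_zero]

open Complex Metric ArithmeticFunction in
theorem re_LSeries_vonMangoldt_le {η t : ℝ} (hη : 0 < η) (hη1 : η ≤ 1) :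
    (LSeries (fun n : ℕ => (ArithmeticFunction.vonMangoldt n : ℂ)) (1 + η + t * I)).re ≤
      (1 / (η + t * I : ℂ)).re + 48 * Real.log (8 * (|t| + 3) / η) := by
  have hs : 1 < (1 + η + t * I : ℂ).re := by simpa using hη
  have ht := abs_nonneg t
  have hM : 0 < Real.log (8 * (|t| + 3) / η) := by
    apply Real.log_pos
    rw [lt_div_iff₀ hη]
    linarith
  have h := neg_re_logDeriv_le (R := 1 / 2) (by norm_num) (mul_pos two_pos hM)
    differentiable_riemannZeta₁ (riemannZeta₁_ne_zero_of_one_le_re hs.le)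
    (fun z hz => norm_riemannZeta₁_le_exp_mul hη hη1 hz) (fun z _ hz => by
      by_contra hlt
      exact riemannZeta₁_ne_zero_of_one_le_re (by linarith) hz)
  rw [logDeriv_riemannZeta₁ hs, show (1 : ℂ) + η + t * I - 1 = η + t * I by ring] at h
  rw [ArithmeticFunction.LSeries_vonMangoldt_eq_deriv_riemannZeta_div hs, neg_div, neg_re]
  rw [add_re] at h
  linarith

namespace DirichletCharacter

variable {q : ℕ} [NeZero q]

open Complex Metric ArithmeticFunction in
theorem LSeries_mul_vonMangoldt_eq_neg_logDeriv (χ : DirichletCharacter ℂ q) {s : ℂ} (hs : 1 < s.re) :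
    LSeries ((fun n : ℕ => (χ n : ℂ)) * (fun n : ℕ => (ArithmeticFunction.vonMangoldt n : ℂ))) s = -logDeriv (LFunction χ) s := by
  rw [LSeries_twist_vonMangoldt_eq χ hs, ← LFunction_eq_LSeries χ hs,
    ← deriv_LFunction_eq_deriv_LSeries χ hs, logDeriv_apply, neg_div]

theorem log_const_pos {η t : ℝ} (hη : 0 < η) (hη1 : η ≤ 1) :
    0 < Real.log (8 * q * (|t| + 3) / η) := by
  have hq : (1 : ℝ) ≤ q := by exact_mod_cast NeZero.one_le
  have ht := abs_nonneg t
  apply Real.log_pos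
  rw [lt_div_iff₀ hη]
  nlinarith

open Complex Metric ArithmeticFunction in
theorem re_LSeries_mul_vonMangoldt_le {χ : DirichletCharacter ℂ q} (hχ : χ ≠ 1) {η t : ℝ}
    (hη : 0 < η) (hη1 : η ≤ 1) :
    (LSeries ((fun n : ℕ => (χ n : ℂ)) * (fun n : ℕ => (ArithmeticFunction.vonMangoldt n : ℂ))) (1 + η + t * I)).re ≤
      24 * Real.log (8 * q * (|t| + 3) / η) := by
  have hs : 1 < (1 + η + t * I : ℂ).re := by simpa using hη
  have h := neg_re_logDeriv_le (R := 1 / 2) (by norm_num) (log_const_pos (q := q) (t := t) hη hη1)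
    (differentiable_LFunction hχ) (LFunction_ne_zero_of_one_le_re χ (.inl hχ) hs.le)
    (fun z hz => norm_LFunction_le_exp_mul hχ hη hη1 hz) (fun z _ hz => by
      by_contra hlt
      exact LFunction_ne_zero_of_one_le_re χ (.inl hχ) (by linarith) hz)
  rw [LSeries_mul_vonMangoldt_eq_neg_logDeriv χ hs, neg_re]
  linarith

open Complex Metric ArithmeticFunction in
theorem re_LSeries_mul_vonMangoldt_le_of_zero {χ : DirichletCharacter ℂ q} (hχ : χ ≠ 1) {η β t : ℝ}
    (hη : 0 < η) (hη1 : η ≤ 1) (hβ1 : β < 1) (hβ : η + (1 - β) < 1 / 6)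
    (h0 : LFunction χ (β + t * I) = 0) :
    (LSeries ((fun n : ℕ => (χ n : ℂ)) * (fun n : ℕ => (ArithmeticFunction.vonMangoldt n : ℂ))) (1 + η + t * I)).re ≤
      24 * Real.log (8 * q * (|t| + 3) / η) - 1 / (η + (1 - β)) := by
  have hs : 1 < (1 + η + t * I : ℂ).re := by simpa using hη
  have e : (1 + η + t * I : ℂ) - (β + t * I) = ((η + (1 - β) : ℝ) : ℂ) := by
    push_cast; ring
  have h := neg_re_logDeriv_le_of_zero (ρ := β + t * I) (R := 1 / 2) (by norm_num)
    (log_const_pos (q := q) (t := t) hη hη1)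
    (differentiable_LFunction hχ) (LFunction_ne_zero_of_one_le_re χ (.inl hχ) hs.le)
    (fun z hz => norm_LFunction_le_exp_mul hχ hη hη1 hz) (fun z _ hz => by
      by_contra hlt
      exact LFunction_ne_zero_of_one_le_re χ (.inl hχ) (by linarith) hz)
    (by
      rw [mem_ball, dist_comm, dist_eq, e, norm_real, Real.norm_of_nonneg (by linarith)]
      linarith) h0
  rw [e, ← ofReal_one, ← ofReal_div, ofReal_re] at h
  rw [LSeries_mul_vonMangoldt_eq_neg_logDeriv χ hs, neg_re]
  push_cast at h
  linarith

end DirichletCharacter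

namespace DirichletCharacter

variable {q : ℕ} [NeZero q]

theorem apply_eq_zero_or_norm_eq_one (χ : DirichletCharacter ℂ q) (a : ZMod q) :
    χ a = 0 ∨ ‖χ a‖ = 1 := by
  by_cases ha : IsUnit a
  · right
    obtain ⟨u, rfl⟩ := ha
    exact χ.unit_norm_eq_one u
  · left
    exact χ.map_nonunit ha

open Complex ArithmeticFunction in
/-- A zero-free region for a nontrivial Dirichlet `L`-function, away from the real axis if the
character is quadratic. -/
theorem lt_of_LFunction_eq_zero {χ : DirichletCharacter ℂ q} (hχ : χ ≠ 1) {η β t : ℝ}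
    (hη : 0 < η) (hη1 : η ≤ 1 / 12) (h : η * Real.log (8 * q * (2 * |t| + 3) / η) ≤ 1 / 800)
    (h2 : χ ^ 2 ≠ 1 ∨ 2 * η ≤ |t|) (h0 : LFunction χ (β + t * I) = 0) : β < 1 - η / 10 := by
  by_contra! hβ
  have hη' : η ≤ 1 := by linarith
  have hβ1 : β < 1 := by
    by_contra! h1
    exact LFunction_ne_zero_of_one_le_re χ (s := β + t * I) (.inl hχ) (by simpa using h1) h0
  have hq : (1 : ℝ) ≤ q := by exact_mod_cast NeZero.one_le
  have ht := abs_nonneg t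
  set ℒ := Real.log (8 * q * (2 * |t| + 3) / η) with hℒ
  have b1 : Real.log (8 * (|(0 : ℝ)| + 3) / η) ≤ ℒ := by
    apply Real.log_le_log (by positivity)
    gcongr
    · linarith
    · simp
  have b2 : Real.log (8 * q * (|t| + 3) / η) ≤ ℒ := by
    apply Real.log_le_log (by positivity)
    gcongr
    linarith
  have b3 : Real.log (8 * q * (|2 * t| + 3) / η) ≤ ℒ := by
    rw [abs_mul, abs_two]
  have b4 : Real.log (8 * (|2 * t| + 3) / η) ≤ ℒ := by
    rw [abs_mul, abs_two]
    apply Real.log_le_log (by positivity)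
    gcongr
    linarith
  have z1 := re_LSeries_vonMangoldt_le (t := 0) hη hη'
  have z2 := re_LSeries_mul_vonMangoldt_le_of_zero hχ hη hη' hβ1 (by linarith) h0
  rw [show (1 + η + (0 : ℝ) * I : ℂ) = ((1 + η : ℝ) : ℂ) by push_cast; ring,
    show (η + (0 : ℝ) * I : ℂ) = (η : ℂ) by push_cast; ring, ← ofReal_one, ← ofReal_div,
    ofReal_re] at z1
  have e2 : (1 + η + t * I : ℂ) = ((1 + η : ℝ) : ℂ) + t * I := by push_cast; ring
  have e3 : (1 + η + (2 * t : ℝ) * I : ℂ) = ((1 + η : ℝ) : ℂ) + 2 * t * I := by push_cast; ring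
  rw [e2] at z2
  have hinv : 10 / (11 * η) ≤ 1 / (η + (1 - β)) := by
    rw [div_le_div_iff₀ (by positivity) (by linarith)]
    linarith
  obtain ⟨g, hg, hfg, hb⟩ : ∃ g : ℕ → ℂ, (∀ n, ‖g n‖ ≤ 1) ∧
      (∀ n : ℕ, χ n = 0 ∨ (‖χ n‖ = 1 ∧ g n = χ n ^ 2)) ∧
      (LSeries (g * (fun n : ℕ => (ArithmeticFunction.vonMangoldt n : ℂ))) (((1 + η : ℝ) : ℂ) + 2 * t * I)).re ≤
        1 / (10 * η) + 48 * ℒ := by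
    by_cases hχ2 : χ ^ 2 = 1
    · have ht2 : 2 * η ≤ |t| := h2.resolve_left (not_not.mpr hχ2)
      refine ⟨1, by simp, fun n => ?_, ?_⟩
      · by_cases hn : IsUnit (n : ZMod q)
        · right
          have : χ (n : ZMod q) ^ 2 = 1 := by
            rw [← MulChar.pow_apply' χ two_ne_zero, hχ2, MulChar.one_apply hn]
          refine ⟨?_, this.symm⟩
          rcases χ.apply_eq_zero_or_norm_eq_one (n : ZMod q) with h | h
          · rw [h] at this; norm_num at this
          · exact h
        · left
          exact χ.map_nonunit hn
      · have z3 := re_LSeries_vonMangoldt_le (t := 2 * t) hη hη'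
        rw [e3] at z3
        rw [one_mul]
        refine z3.trans ?_
        have : (1 / (η + (2 * t : ℝ) * I) : ℂ).re ≤ 1 / (10 * η) := by
          rw [one_div, inv_re, normSq_apply]
          simp only [add_re, ofReal_re, mul_re, I_re, mul_zero, ofReal_im, I_im, mul_one, sub_self,
            add_zero, add_im, mul_im, zero_add]
          rw [div_le_div_iff₀ (by nlinarith [mul_pos hη hη, mul_self_nonneg t]) (by positivity)]
          have : 4 * η ^ 2 ≤ t ^ 2 := by
            rw [← sq_abs t]
            nlinarith
          nlinarith
        linarith
    · refine ⟨(fun n : ℕ => ((χ ^ 2) n : ℂ)), fun n => (χ ^ 2).norm_le_one _, fun n => ?_, ?_⟩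
      · rcases χ.apply_eq_zero_or_norm_eq_one (n : ZMod q) with h | h
        · exact .inl h
        · exact .inr ⟨h, MulChar.pow_apply' χ two_ne_zero _⟩
      · have z3 := re_LSeries_mul_vonMangoldt_le hχ2 (t := 2 * t) hη hη'
        rw [e3] at z3
        have : 0 ≤ 1 / (10 * η) := by positivity
        have := log_const_pos (q := q) (t := 2 * t) hη hη'
        linarith
  have key := three_four_one_LSeries hg hfg (σ := 1 + η) (by linarith) t
  have h3 : 0 ≤ 3 * (1 / η) + 288 * ℒ - 4 * (10 / (11 * η)) + 1 / (10 * η) := by linarith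
  have h4 : 0 ≤ η * (3 * (1 / η) + 288 * ℒ - 4 * (10 / (11 * η)) + 1 / (10 * η)) :=
    mul_nonneg hη.le h3
  have h5 : η * (3 * (1 / η) + 288 * ℒ - 4 * (10 / (11 * η)) + 1 / (10 * η)) =
      3 + 288 * (η * ℒ) - 40 / 11 + 1 / 10 := by
    field_simp
    ring
  rw [h5] at h4
  linarith

end DirichletCharacter

open Filter Topology ComplexOrder in
theorem iteratedDeriv_alternating_of_deriv_eq {f g : ℂ → ℂ} {c : ℂ} (hf : AnalyticAt ℂ f c)
    (hg : AnalyticAt ℂ g c) (hfg : deriv f =ᶠ[𝓝 c] fun s => -(g s * f s)) (h0 : 0 ≤ f c)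
    (hpos : ∀ k : ℕ, 0 ≤ (-1) ^ k * iteratedDeriv k g c) (k : ℕ) :
    0 ≤ (-1) ^ k * iteratedDeriv k f c := by
  induction k using Nat.strong_induction_on with
  | _ k ih =>
    rcases k with _ | k
    · simpa using h0
    · rw [iteratedDeriv_succ', hfg.iteratedDeriv_eq, iteratedDeriv_fun_neg,
        iteratedDeriv_fun_mul hg.contDiffAt hf.contDiffAt, pow_succ, mul_neg_one, neg_mul_neg,
        Finset.mul_sum]
      refine Finset.sum_nonneg fun i hi => ?_
      have hik : i ≤ k := Nat.lt_succ_iff.mp (Finset.mem_range.mp hi)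
      have e : (-1 : ℂ) ^ k = (-1) ^ i * (-1) ^ (k - i) := by
        rw [← pow_add, Nat.add_sub_cancel' hik]
      rw [show (-1 : ℂ) ^ k * (k.choose i * iteratedDeriv i g c * iteratedDeriv (k - i) f c) =
        k.choose i * (((-1) ^ i * iteratedDeriv i g c) *
          ((-1) ^ (k - i) * iteratedDeriv (k - i) f c)) by rw [e]; ring]
      exact mul_nonneg (Nat.cast_nonneg _) (mul_nonneg (hpos i) (ih _ (by omega)))

theorem iteratedDeriv_inv_sub_one_two (k : ℕ) :
    iteratedDeriv k (fun s : ℂ => (s - 1)⁻¹) 2 = (-1) ^ k * k.factorial := by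
  rw [iteratedDeriv_comp_sub_const, iteratedDeriv_eq_iterate]
  have h := iter_deriv_inv k ((2 : ℂ) - 1)
  norm_num at h ⊢

open Complex Filter Topology ComplexOrder Metric in
/-- Estermann's lemma: a lower bound for the residue of `ζ G` at `1`. -/
theorem le_residue_of_alternating {G : ℂ → ℂ} (hG : Differentiable ℂ G) {M l β c : ℝ}
    (hpos : ∀ k : ℕ, 0 ≤ (-1) ^ k * iteratedDeriv k (fun s => riemannZeta s * G s) 2)
    (h2 : c ≤ (riemannZeta 2 * G 2).re) (hl : G 1 = l)
    (hM : ∀ z ∈ sphere (2 : ℂ) (4 / 3), ‖riemannZeta z * G z - l * (z - 1)⁻¹‖ ≤ M)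
    (hβ : 9 / 10 ≤ β) (hβ1 : β < 1) (h0 : (riemannZeta β * G β).re ≤ 0) {K : ℕ} (hK : 0 < K)
    (hMK : M * (33 / 40) ^ K * (40 / 7) ≤ c / 2) : c / 2 * (1 - β) ≤ l * (2 - β) ^ K := by
  set φ : ℂ → ℂ := fun s => riemannZeta₀ s * G s + dslope G 1 s with hφ
  have hφd : Differentiable ℂ φ := by
    refine (differentiable_riemannZeta₀.mul hG).add fun z => ?_
    exact ((differentiableOn_dslope univ_mem).mpr hG.differentiableOn).differentiableAt univ_mem
  have hφe : ∀ s, s ≠ 1 → φ s = riemannZeta s * G s - l * (s - 1)⁻¹ := by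
    intro s hs
    have hs' : s - 1 ≠ 0 := sub_ne_zero_of_ne hs
    simp only [hφ]
    rw [riemannZeta_eq_inv_sub_add hs, dslope_of_ne _ hs, slope_def_field, hl]
    field_simp
    ring
  have hne : ∀ᶠ s in 𝓝 (2 : ℂ), s ≠ 1 := isOpen_ne.mem_nhds (by norm_num)
  set a : ℕ → ℝ := fun k => ((-1) ^ k * iteratedDeriv k (fun s => riemannZeta s * G s) 2).re /
    k.factorial with ha
  have ha0 : ∀ k, 0 ≤ a k := fun k => div_nonneg (by simpa using (hpos k).1) (by positivity)
  have hder : ∀ k, (-1) ^ k * iteratedDeriv k φ 2 = ((k.factorial * (a k - l) : ℝ) : ℂ) := by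
    intro k
    have h1 : φ =ᶠ[𝓝 2] fun s => riemannZeta s * G s - l * (s - 1)⁻¹ := by
      filter_upwards [hne] with s hs using hφe s hs
    have hz : AnalyticAt ℂ (fun s => riemannZeta s * G s) 2 := by
      rw [analyticAt_iff_eventually_differentiableAt]
      filter_upwards [hne] with s hs using (differentiableAt_riemannZeta hs).mul (hG s)
    have hi : AnalyticAt ℂ (fun s : ℂ => (l : ℂ) * (s - 1)⁻¹) 2 := by
      fun_prop (disch := norm_num)
    have hr : (-1) ^ k * iteratedDeriv k (fun s => riemannZeta s * G s) 2 =
        ((k.factorial * a k : ℝ) : ℂ) := by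
      have : (((-1) ^ k * iteratedDeriv k (fun s => riemannZeta s * G s) 2).re : ℂ) =
          (-1) ^ k * iteratedDeriv k (fun s => riemannZeta s * G s) 2 :=
        Complex.ext (by simp) (by simpa using (hpos k).2)
      rw [← this, ha]
      congr 1
      field_simp
    rw [h1.iteratedDeriv_eq, iteratedDeriv_fun_sub hz.contDiffAt hi.contDiffAt, mul_sub, hr,
      iteratedDeriv_const_mul_field, iteratedDeriv_inv_sub_one_two, mul_left_comm, ← mul_assoc,
      mul_comm (l : ℂ), mul_assoc, mul_comm (l : ℂ), ← mul_assoc, ← mul_assoc, ← pow_add,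
      Even.neg_one_pow ⟨k, rfl⟩]
    push_cast
    ring
  have hcauchy : ∀ k, |a k - l| ≤ M * (3 / 4) ^ k := by
    intro k
    have h := norm_iteratedDeriv_le_of_forall_mem_sphere_norm_le k (by norm_num : (0 : ℝ) < 4 / 3)
      (hφd.diffContOnCl (s := ball 2 (4 / 3))) (C := M) (fun z hz => by
        have : z ≠ 1 := by
          rintro rfl
          rw [mem_sphere, dist_eq] at hz
          norm_num at hz
        rw [hφe z this]
        exact hM z hz)
    have h' := congrArg norm (hder k)
    rw [norm_mul, norm_pow, norm_neg, norm_one, one_pow, one_mul, norm_real, Real.norm_eq_abs,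
      abs_mul, Nat.abs_cast] at h'
    rw [h', mul_div_assoc] at h
    have := le_of_mul_le_mul_left h (by positivity : (0 : ℝ) < k.factorial)
    rwa [div_eq_mul_inv, ← inv_pow, inv_div] at this
  have hM0 : 0 ≤ M := by simpa using (abs_nonneg _).trans (hcauchy 0)
  set x : ℝ := 2 - β with hx
  have hx1 : 1 < x := by linarith
  have hx2 : x ≤ 11 / 10 := by linarith
  have hsum : HasSum (fun k => (a k - l) * x ^ k) (φ β).re := by
    have := hasSum_re (hasSum_taylorSeries_of_entire hφd 2 β)
    convert this using 2 with k
    rw [smul_eq_mul, smul_eq_mul, show ((β : ℂ) - 2) = -1 * (x : ℂ) by rw [hx]; push_cast; ring,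
      mul_pow, mul_right_comm, hder k, ← ofReal_natCast, ← ofReal_pow, ← ofReal_inv, ← ofReal_mul,
      ← ofReal_mul, ofReal_re]
    field_simp
  have hterm : ∀ k, |(a k - l) * x ^ k| ≤ M * (33 / 40) ^ k := by
    intro k
    rw [abs_mul, abs_pow, abs_of_pos (by linarith : 0 < x),
      show (33 / 40 : ℝ) = 3 / 4 * (11 / 10) by norm_num, mul_pow, ← mul_assoc]
    gcongr
    exact hcauchy k
  have htail : -(c / 2) ≤ ∑' k, (a (k + K) - l) * x ^ (k + K) := by
    have hg : HasSum (fun k => M * (33 / 40 : ℝ) ^ K * (33 / 40) ^ k)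
        (M * (33 / 40) ^ K * (1 - 33 / 40)⁻¹) :=
      (hasSum_geometric_of_lt_one (by norm_num) (by norm_num)).mul_left _
    have := tsum_of_norm_bounded hg (f := fun k => (a (k + K) - l) * x ^ (k + K)) (fun k => by
      refine (hterm (k + K)).trans (le_of_eq ?_)
      rw [pow_add]; ring)
    rw [Real.norm_eq_abs] at this
    have h3 := (abs_le.mp this).1
    norm_num at h3 hMK ⊢
    linarith
  have hhead : c - l * ∑ k ∈ Finset.range K, x ^ k ≤ ∑ k ∈ Finset.range K, (a k - l) * x ^ k := by
    simp only [sub_mul, Finset.sum_sub_distrib, ← Finset.mul_sum]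
    gcongr
    have h1 : a 0 * x ^ 0 ≤ ∑ k ∈ Finset.range K, a k * x ^ k :=
      Finset.single_le_sum (f := fun k => a k * x ^ k)
        (fun k _ => mul_nonneg (ha0 k) (by positivity)) (Finset.mem_range.mpr hK)
    refine le_trans ?_ h1
    simpa [ha] using h2
  have hgeom : (∑ k ∈ Finset.range K, x ^ k) * (x - 1) = x ^ K - 1 := geom_sum_mul x K
  have hφβ : (φ β).re ≤ l / (1 - β) := by
    have hβ' : (β : ℂ) ≠ 1 := by exact_mod_cast hβ1.ne
    rw [hφe β hβ', sub_re, ← ofReal_one, ← ofReal_sub, ← ofReal_inv, ← ofReal_mul, ofReal_re,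
      show β - 1 = -(1 - β) by ring, inv_neg, mul_neg, ← div_eq_mul_inv]
    linarith
  have htot := hsum.summable.sum_add_tsum_nat_add K
  rw [hsum.tsum_eq] at htot
  have h1β : 0 < 1 - β := by linarith
  have h4 : c / 2 - l * ∑ k ∈ Finset.range K, x ^ k ≤ l / (1 - β) := by linarith
  have h5 := mul_le_mul_of_nonneg_right h4 h1β.le
  rw [div_mul_cancel₀ _ h1β.ne', sub_mul, mul_assoc, show 1 - β = x - 1 by rw [hx]; ring, hgeom] at h5
  rw [show 1 - β = x - 1 by rw [hx]; ring]
  linarith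

open Complex Filter Topology ComplexOrder ArithmeticFunction in
theorem iteratedDeriv_zeta_mul_alternating {G : ℂ → ℂ} (hG : Differentiable ℂ G) {a : ℕ → ℂ}
    (ha : ∀ n, 0 ≤ 1 + a n)
    (hG0 : ∀ s : ℂ, 1 < s.re → G s ≠ 0)
    (hGa : ∀ s : ℂ, 1 < s.re → LSeriesSummable (a * (fun n : ℕ => (ArithmeticFunction.vonMangoldt n : ℂ))) s ∧
      LSeries (a * (fun n : ℕ => (ArithmeticFunction.vonMangoldt n : ℂ))) s = -logDeriv G s)
    (h2 : 0 ≤ riemannZeta 2 * G 2) (k : ℕ) :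
    0 ≤ (-1) ^ k * iteratedDeriv k (fun s => riemannZeta s * G s) 2 := by
  set b : ℕ → ℂ := (fun n : ℕ => (ArithmeticFunction.vonMangoldt n : ℂ)) + a * (fun n : ℕ => (ArithmeticFunction.vonMangoldt n : ℂ)) with hb
  have hsum : ∀ s : ℂ, 1 < s.re → LSeriesSummable b s := fun s hs =>
    (ArithmeticFunction.LSeriesSummable_vonMangoldt hs).add (hGa s hs).1
  have habs : LSeries.abscissaOfAbsConv b < ((2 : ℝ) : ℂ).re := by
    refine ((hsum ((3 / 2 : ℝ) : ℂ) (by norm_num)).abscissaOfAbsConv_le).trans_lt ?_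
    simp only [ofReal_re, EReal.coe_lt_coe_iff]
    norm_num
  have hb0 : (0 : ℕ → ℂ) ≤ b := fun n => by
    have : b n = (1 + a n) * (ArithmeticFunction.vonMangoldt n : ℂ) := by
      simp only [hb, Pi.add_apply, Pi.mul_apply]; ring
    rw [this]
    exact mul_nonneg (ha n) (by
      have := ArithmeticFunction.vonMangoldt_nonneg (n := n)
      exact zero_le_real.mpr this)
  have hopen : ∀ᶠ s in 𝓝 (2 : ℂ), 1 < s.re :=
    (isOpen_lt continuous_const continuous_re).mem_nhds (by simp)
  refine iteratedDeriv_alternating_of_deriv_eq (f := fun s => riemannZeta s * G s)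
    (g := LSeries b) ?_ ?_ ?_ h2 (fun k => ?_) k
  · rw [analyticAt_iff_eventually_differentiableAt]
    filter_upwards [hopen] with s hs
    exact (differentiableAt_riemannZeta (by rintro rfl; simp at hs)).mul (hG s)
  · exact LSeries_analyticOnNhd b _ (by simpa using habs)
  · filter_upwards [hopen] with s hs
    have hs1 : s ≠ 1 := by rintro rfl; simp at hs
    have hz := riemannZeta_ne_zero_of_one_lt_re hs
    have hg := hG0 s hs
    rw [hb, LSeries_add (ArithmeticFunction.LSeriesSummable_vonMangoldt hs) (hGa s hs).1,
      (hGa s hs).2, ArithmeticFunction.LSeries_vonMangoldt_eq_deriv_riemannZeta_div hs,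
      deriv_fun_mul (differentiableAt_riemannZeta hs1) (hG s), logDeriv_apply]
    field_simp
    ring
  · have := LSeries.iteratedDeriv_alternating (x := 2) hb0 (by simpa using habs) k
    rwa [ofReal_ofNat] at this

open Complex Metric ComplexOrder ArithmeticFunction in
theorem le_residue_of_zeta_mul {G : ℂ → ℂ} (hG : Differentiable ℂ G) {a : ℕ → ℂ} {B l β y : ℝ}
    (ha : ∀ n, 0 ≤ 1 + a n)
    (hG0 : ∀ s : ℂ, 1 < s.re → G s ≠ 0)
    (hGa : ∀ s : ℂ, 1 < s.re → LSeriesSummable (a * (fun n : ℕ => (ArithmeticFunction.vonMangoldt n : ℂ))) s ∧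
      LSeries (a * (fun n : ℕ => (ArithmeticFunction.vonMangoldt n : ℂ))) s = -logDeriv G s)
    (hy : G 2 = y) (hy1 : 1 / 27 ≤ y) (hl : G 1 = l) (hB1 : 1 ≤ B)
    (hB : ∀ z : ℂ, 2 / 3 ≤ z.re → ‖z‖ ≤ 10 / 3 → ‖G z‖ ≤ B)
    (hβ : 9 / 10 ≤ β) (hβ1 : β < 1) (h0 : (riemannZeta β * G β).re ≤ 0) :
    (1 - β) / 54 * Real.exp (-((6 * Real.log (4000 * B) + 1) * (1 - β))) ≤ l := by
  have hz2 : ∃ z : ℝ, 1 ≤ z ∧ riemannZeta 2 = z := by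
    refine ⟨Real.pi ^ 2 / 6, ?_, by rw [riemannZeta_two]; push_cast; rfl⟩
    nlinarith [Real.pi_gt_three]
  obtain ⟨z2, hz2, hz2'⟩ := hz2
  have h2e : riemannZeta 2 * G 2 = ((z2 * y : ℝ) : ℂ) := by rw [hz2', hy]; push_cast; rfl
  have hzy : 1 / 27 ≤ z2 * y := by nlinarith
  have hpos := iteratedDeriv_zeta_mul_alternating hG ha hG0 hGa
    (by rw [h2e]; exact_mod_cast (by linarith : 0 ≤ z2 * y))
  have hlog : 0 ≤ Real.log (4000 * B) := Real.log_nonneg (by linarith)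
  set K := ⌈6 * Real.log (4000 * B)⌉₊ with hK
  have hK1 : 6 * Real.log (4000 * B) ≤ K := Nat.le_ceil _
  have hK2 : (K : ℝ) ≤ 6 * Real.log (4000 * B) + 1 := (Nat.ceil_lt_add_one (by positivity)).le
  have hK0 : 0 < K := by
    rw [hK, Nat.ceil_pos]
    have : 0 < Real.log (4000 * B) := Real.log_pos (by linarith)
    positivity
  have hpow : (33 / 40 : ℝ) ^ K ≤ (4000 * B)⁻¹ := by
    have h1 : (33 / 40 : ℝ) ≤ Real.exp (-(1 / 6)) := by
      have := Real.add_one_le_exp (-(1 / 6) : ℝ)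
      linarith
    calc (33 / 40 : ℝ) ^ K ≤ Real.exp (-(1 / 6)) ^ K := by gcongr
      _ = Real.exp (-(K / 6)) := by rw [← Real.exp_nat_mul]; ring_nf
      _ ≤ Real.exp (-Real.log (4000 * B)) := by gcongr; linarith
      _ = _ := by rw [Real.exp_neg, Real.exp_log (by linarith)]
  have hMK : 12 * B * (33 / 40) ^ K * (40 / 7) ≤ 1 / 27 / 2 := by
    calc 12 * B * (33 / 40) ^ K * (40 / 7) ≤ 12 * B * (4000 * B)⁻¹ * (40 / 7) := by gcongr
      _ = 12 / 4000 * (40 / 7) := by field_simp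
      _ ≤ _ := by norm_num
  have hM : ∀ z ∈ sphere (2 : ℂ) (4 / 3), ‖riemannZeta z * G z - l * (z - 1)⁻¹‖ ≤ 12 * B := by
    intro z hz
    rw [mem_sphere, dist_eq] at hz
    have hre : 2 / 3 ≤ z.re := by
      have := (abs_le.mp ((abs_re_le_norm (z - 2)).trans hz.le)).1
      simp at this
      linarith
    have hnz : ‖z‖ ≤ 10 / 3 := by
      calc ‖z‖ = ‖(z - 2) + 2‖ := by simp
        _ ≤ ‖z - 2‖ + ‖(2 : ℂ)‖ := norm_add_le _ _
        _ = _ := by rw [hz]; norm_num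
    have hz1 : 1 / 3 ≤ ‖z - 1‖ := by
      have := norm_add_le (z - 1) (-1)
      rw [show z - 1 + -1 = z - 2 by ring, hz, norm_neg, norm_one] at this
      linarith
    have hz1' : z ≠ 1 := by rintro rfl; norm_num at hz1
    have hinv : ‖(z - 1)⁻¹‖ ≤ 3 := by
      rw [norm_inv]
      exact inv_le_of_inv_le₀ (by norm_num) (by linarith)
    have hzeta : ‖riemannZeta z‖ ≤ 9 := by
      rw [riemannZeta_eq_inv_sub_add hz1']
      refine (norm_add_le _ _).trans ?_
      have h3 := norm_riemannZeta₀_le (s := z) (by linarith)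
      have h4 : ‖z‖ / z.re ≤ 5 := by
        rw [div_le_iff₀ (by linarith)]
        linarith
      linarith
    have hlB : ‖(l : ℂ)‖ ≤ B := by
      rw [← hl]
      exact hB 1 (by norm_num) (by norm_num)
    calc _ ≤ ‖riemannZeta z‖ * ‖G z‖ + ‖(l : ℂ)‖ * ‖(z - 1)⁻¹‖ := by
          rw [← norm_mul, ← norm_mul]; exact norm_sub_le _ _
      _ ≤ 9 * B + B * 3 := by
        gcongr
        exact hB z hre hnz
      _ = _ := by ring
  have key := le_residue_of_alternating hG hpos (by rw [h2e, ofReal_re]; exact hzy) hl hM hβ hβ1 h0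
    hK0 hMK
  have hexp : (2 - β) ^ K ≤ Real.exp ((6 * Real.log (4000 * B) + 1) * (1 - β)) := by
    calc (2 - β) ^ K ≤ Real.exp (1 - β) ^ K := by
          have h1 := Real.add_one_le_exp (1 - β)
          exact pow_le_pow_left₀ (by linarith) (by linarith) K
      _ = Real.exp (K * (1 - β)) := by rw [← Real.exp_nat_mul]
      _ ≤ _ := by gcongr
  have hl0 : 0 < l := by
    by_contra! hneg
    have h1 : l * (2 - β) ^ K ≤ 0 := mul_nonpos_of_nonpos_of_nonneg hneg (by
      have : 0 ≤ 2 - β := by linarith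
      positivity)
    nlinarith
  rw [Real.exp_neg, ← div_eq_mul_inv, div_le_iff₀ (Real.exp_pos _)]
  calc (1 - β) / 54 = 1 / 27 / 2 * (1 - β) := by ring
    _ ≤ l * (2 - β) ^ K := key
    _ ≤ _ := by gcongr

open Complex in
theorem DirichletCharacter.exists_LFunction_two {q : ℕ} [NeZero q] {χ : DirichletCharacter ℂ q}
    (hχ : χ ≠ 1) (hχ2 : χ ^ 2 = 1) : ∃ y : ℝ, 1 / 3 ≤ y ∧ LFunction χ 2 = y := by
  have him : (LFunction χ 2).im = 0 := by
    simpa using LFunction_ofReal_im hχ hχ2 (σ := 2) two_pos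
  refine ⟨(LFunction χ 2).re, ?_, Complex.ext (by simp) (by simpa using him)⟩
  have h2 : 1 < (2 : ℂ).re := by norm_num
  have s1 : LSeriesSummable (1 : ℕ → ℂ) 2 := LSeriesSummable_one_iff.mpr h2
  have sχ := LSeriesSummable_of_one_lt_re χ h2
  have hz : HasSum (fun n => (LSeries.term (1 : ℕ → ℂ) 2 n).re) (Real.pi ^ 2 / 6) := by
    have := hasSum_re s1.hasSum
    have e : ∑' n, LSeries.term (1 : ℕ → ℂ) 2 n = ((Real.pi ^ 2 / 6 : ℝ) : ℂ) := by
      change LSeries 1 2 = _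
      rw [LSeries_one_eq_riemannZeta h2, riemannZeta_two]
      push_cast; rfl
    rwa [e, ofReal_re] at this
  have hL : HasSum (fun n => (LSeries.term (fun n : ℕ => (χ n : ℂ)) 2 n).re) (LFunction χ 2).re := by
    rw [LFunction_eq_LSeries χ h2]
    exact hasSum_re sχ.hasSum
  have htot := hz.add hL
  have h1 := le_hasSum htot 1 (fun n _ => by
    have := norm_term_le_re_term_one (f := (fun n : ℕ => (χ n : ℂ))) (fun n => χ.norm_le_one _) 2 n
    have h3 := (abs_le.mp ((abs_re_le_norm _).trans this)).1
    norm_num at h3 ⊢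
    linarith)
  rw [LSeries.term_of_ne_zero one_ne_zero, LSeries.term_of_ne_zero one_ne_zero] at h1
  norm_num at h1
  have hpi : Real.pi ^ 2 ≤ 10 := by nlinarith [Real.pi_lt_d2, Real.pi_gt_three]
  linarith

namespace DirichletCharacter

variable {q : ℕ} [NeZero q]

theorem norm_LFunction_le_five_mul {χ : DirichletCharacter ℂ q} (hχ : χ ≠ 1) {z : ℂ}
    (hz : 2 / 3 ≤ z.re) (hz' : ‖z‖ ≤ 10 / 3) : ‖LFunction χ z‖ ≤ 5 * q := by
  refine (norm_LFunction_le hχ zero_le_one le_rfl (by linarith)).trans ?_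
  have hre : (2 / 3 : ℝ) ≤ z.re - 1 + 1 := by linarith
  rw [Real.rpow_one]
  calc ‖z‖ * (q / (z.re - 1 + 1)) ≤ 10 / 3 * (q / (2 / 3)) :=
        mul_le_mul hz' (by gcongr) (by positivity) (by norm_num)
    _ = _ := by ring

open ComplexOrder in
theorem one_add_apply_nonneg {χ : DirichletCharacter ℂ q} (hχ2 : χ ^ 2 = 1) (a : ZMod q) :
    0 ≤ 1 + χ a := by
  by_cases ha : IsUnit a
  · have h : χ a ^ 2 = 1 := by
      rw [← MulChar.pow_apply' χ two_ne_zero, hχ2, MulChar.one_apply ha]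
    rw [sq] at h
    rcases mul_self_eq_one_iff.mp h with h | h <;> simp [h]
    norm_num
  · simp [χ.map_nonunit ha]

theorem exists_LFunction_ofReal {χ : DirichletCharacter ℂ q} (hχ : χ ≠ 1) (hχ2 : χ ^ 2 = 1) {σ : ℝ}
    (hσ : 0 < σ) : ∃ y : ℝ, LFunction χ σ = y :=
  ⟨(LFunction χ σ).re, Complex.ext (by simp) (by simpa using LFunction_ofReal_im hχ hχ2 hσ)⟩

theorem le_LFunction_one_of_nonpos {χ : DirichletCharacter ℂ q} (hχ : χ ≠ 1) (hχ2 : χ ^ 2 = 1)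
    {β : ℝ} (hβ : 9 / 10 ≤ β) (hβ1 : β < 1) (h0 : (riemannZeta β * LFunction χ β).re ≤ 0) :
    (1 - β) / 54 * Real.exp (-((6 * Real.log (4000 * (5 * q)) + 1) * (1 - β))) ≤
      ‖LFunction χ 1‖ := by
  have hq : (1 : ℝ) ≤ q := by exact_mod_cast NeZero.one_le
  obtain ⟨y, hy, hy'⟩ := exists_LFunction_two hχ hχ2
  obtain ⟨l, hl⟩ := exists_LFunction_ofReal hχ hχ2 one_pos
  rw [Complex.ofReal_one] at hl
  rw [hl, Complex.norm_real]
  refine le_trans ?_ (Real.le_norm_self l)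
  exact le_residue_of_zeta_mul (differentiable_LFunction hχ) (a := (fun n : ℕ => (χ n : ℂ)))
    (fun n => one_add_apply_nonneg hχ2 n)
    (fun s hs => LFunction_ne_zero_of_one_le_re χ (.inl hχ) hs.le)
    (fun s hs => ⟨LSeriesSummable_twist_vonMangoldt χ hs, LSeries_mul_vonMangoldt_eq_neg_logDeriv χ hs⟩)
    hy' (by linarith) hl (by linarith) (fun z h1 h2 => norm_LFunction_le_five_mul hχ h1 h2) hβ hβ1 h0

variable {q₁ q₂ : ℕ} [NeZero q₁] [NeZero q₂]

/-- The product of two Dirichlet characters, as a character modulo the product of the moduli. -/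
noncomputable def mulLevel (χ₁ : DirichletCharacter ℂ q₁) (χ₂ : DirichletCharacter ℂ q₂) :
    DirichletCharacter ℂ (q₁ * q₂) :=
  changeLevel (dvd_mul_right q₁ q₂) χ₁ * changeLevel (dvd_mul_left q₂ q₁) χ₂

theorem mulLevel_apply_natCast (χ₁ : DirichletCharacter ℂ q₁) (χ₂ : DirichletCharacter ℂ q₂) (n : ℕ) :
    mulLevel χ₁ χ₂ (n : ZMod (q₁ * q₂)) = χ₁ (n : ZMod q₁) * χ₂ (n : ZMod q₂) := by
  by_cases hn : IsUnit (n : ZMod (q₁ * q₂))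
  · have e1 := changeLevel_eq_cast_of_dvd χ₁ (dvd_mul_right q₁ q₂) hn.unit
    have e2 := changeLevel_eq_cast_of_dvd χ₂ (dvd_mul_left q₂ q₁) hn.unit
    rw [IsUnit.unit_spec, ZMod.cast_natCast (dvd_mul_right q₁ q₂)] at e1
    rw [IsUnit.unit_spec, ZMod.cast_natCast (dvd_mul_left q₂ q₁)] at e2
    rw [mulLevel, MulChar.mul_apply, e1, e2]
  · rw [(mulLevel χ₁ χ₂).map_nonunit hn]
    rw [ZMod.isUnit_iff_coprime, Nat.coprime_mul_iff_right, not_and_or] at hn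
    rcases hn with hn | hn
    · rw [χ₁.map_nonunit (by rwa [ZMod.isUnit_iff_coprime]), zero_mul]
    · rw [χ₂.map_nonunit (by rwa [ZMod.isUnit_iff_coprime]), mul_zero]

omit [NeZero q₁] [NeZero q₂] in
theorem mulLevel_sq {χ₁ : DirichletCharacter ℂ q₁} {χ₂ : DirichletCharacter ℂ q₂} (h1 : χ₁ ^ 2 = 1)
    (h2 : χ₂ ^ 2 = 1) : mulLevel χ₁ χ₂ ^ 2 = 1 := by
  rw [mulLevel, mul_pow, ← map_pow, ← map_pow, h1, h2, map_one, map_one, one_mul]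

theorem eq_of_mulLevel_eq_one {χ₁ : DirichletCharacter ℂ q₁} {χ₂ : DirichletCharacter ℂ q₂}
    (h2 : χ₂ ^ 2 = 1) (hp1 : χ₁.IsPrimitive) (hp2 : χ₂.IsPrimitive)
    (h : mulLevel χ₁ χ₂ = 1) : q₁ = q₂ := by
  have h3 : changeLevel (dvd_mul_left q₂ q₁) χ₂ * changeLevel (dvd_mul_left q₂ q₁) χ₂ = 1 := by
    rw [← sq, ← map_pow, h2, map_one]
  have h4 : changeLevel (dvd_mul_right q₁ q₂) χ₁ = changeLevel (dvd_mul_left q₂ q₁) χ₂ :=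
    mul_right_cancel (h.trans h3.symm)
  have h5 := congrArg conductor h4
  rwa [conductor_changeLevel, conductor_changeLevel, hp1, hp2] at h5

open ComplexOrder ArithmeticFunction in
theorem le_LFunction_one_of_zero {χ₁ : DirichletCharacter ℂ q₁} {χ₂ : DirichletCharacter ℂ q₂}
    (h1 : χ₁ ≠ 1) (h2 : χ₂ ≠ 1) (h3 : mulLevel χ₁ χ₂ ≠ 1) (h1' : χ₁ ^ 2 = 1) (h2' : χ₂ ^ 2 = 1)
    {β : ℝ} (hβ : 9 / 10 ≤ β) (hβ1 : β < 1) (h0 : LFunction χ₁ β = 0) :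
    (1 - β) / 54 * Real.exp (-((6 * Real.log (4000 * ((5 * q₁) * (5 * q₂) * (5 * (q₁ * q₂)))) + 1) *
      (1 - β))) ≤
      ‖LFunction χ₁ 1‖ * ‖LFunction χ₂ 1‖ * ‖LFunction (mulLevel χ₁ χ₂) 1‖ := by
  have hq1 : (1 : ℝ) ≤ q₁ := by exact_mod_cast NeZero.one_le
  have hq2 : (1 : ℝ) ≤ q₂ := by exact_mod_cast NeZero.one_le
  set ψ := mulLevel χ₁ χ₂ with hψ
  have h3' : ψ ^ 2 = 1 := mulLevel_sq h1' h2'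
  obtain ⟨y1, hy1, hy1'⟩ := exists_LFunction_two h1 h1'
  obtain ⟨y2, hy2, hy2'⟩ := exists_LFunction_two h2 h2'
  obtain ⟨y3, hy3, hy3'⟩ := exists_LFunction_two h3 h3'
  obtain ⟨l1, hl1⟩ := exists_LFunction_ofReal h1 h1' one_pos
  obtain ⟨l2, hl2⟩ := exists_LFunction_ofReal h2 h2' one_pos
  obtain ⟨l3, hl3⟩ := exists_LFunction_ofReal h3 h3' one_pos
  rw [Complex.ofReal_one] at hl1 hl2 hl3
  rw [hl1, hl2, hl3, Complex.norm_real, Complex.norm_real, Complex.norm_real, ← norm_mul, ← norm_mul]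
  refine le_trans ?_ (Real.le_norm_self _)
  have hne : ∀ {q : ℕ} [NeZero q] {χ : DirichletCharacter ℂ q}, χ ≠ 1 → ∀ s : ℂ, 1 < s.re →
      LFunction χ s ≠ 0 := fun hχ s hs => LFunction_ne_zero_of_one_le_re _ (.inl hχ) hs.le
  refine le_residue_of_zeta_mul (G := fun s => LFunction χ₁ s * LFunction χ₂ s * LFunction ψ s)
    (((differentiable_LFunction h1).mul (differentiable_LFunction h2)).mul
      (differentiable_LFunction h3)) (a := (fun n : ℕ => (χ₁ n : ℂ)) + (fun n : ℕ => (χ₂ n : ℂ)) + (fun n : ℕ => (ψ n : ℂ))) (y := y1 * y2 * y3)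
    (fun n => ?_) (fun s hs => mul_ne_zero (mul_ne_zero (hne h1 s hs) (hne h2 s hs)) (hne h3 s hs))
    (fun s hs => ⟨?_, ?_⟩) ?_ ?_ ?_ ?_ (fun z hz hz' => ?_) hβ hβ1 ?_
  · have : 1 + ((fun n : ℕ => (χ₁ n : ℂ)) + (fun n : ℕ => (χ₂ n : ℂ)) + (fun n : ℕ => (ψ n : ℂ)) : ℕ → ℂ) n = (1 + χ₁ (n : ZMod q₁)) * (1 + χ₂ (n : ZMod q₂)) := by
      simp only [Pi.add_apply, hψ, mulLevel_apply_natCast]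
      ring
    rw [this]
    exact mul_nonneg (one_add_apply_nonneg h1' _) (one_add_apply_nonneg h2' _)
  · rw [add_mul, add_mul]
    exact ((LSeriesSummable_twist_vonMangoldt χ₁ hs).add
      (LSeriesSummable_twist_vonMangoldt χ₂ hs)).add (LSeriesSummable_twist_vonMangoldt ψ hs)
  · have s1 := LSeriesSummable_twist_vonMangoldt χ₁ hs
    have s2 := LSeriesSummable_twist_vonMangoldt χ₂ hs
    have s3 := LSeriesSummable_twist_vonMangoldt ψ hs
    rw [add_mul, add_mul, LSeries_add (s1.add s2) s3, LSeries_add s1 s2,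
      LSeries_mul_vonMangoldt_eq_neg_logDeriv χ₁ hs, LSeries_mul_vonMangoldt_eq_neg_logDeriv χ₂ hs,
      LSeries_mul_vonMangoldt_eq_neg_logDeriv ψ hs,
      logDeriv_mul (f := fun s => LFunction χ₁ s * LFunction χ₂ s) s
        (mul_ne_zero (hne h1 s hs) (hne h2 s hs)) (hne h3 s hs)
        ((differentiable_LFunction h1).mul (differentiable_LFunction h2) s)
        (differentiable_LFunction h3 s),
      logDeriv_mul s (hne h1 s hs) (hne h2 s hs) (differentiable_LFunction h1 s)
        (differentiable_LFunction h2 s)]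
    ring
  · rw [hy1', hy2', hy3']; push_cast; rfl
  · calc (1 / 27 : ℝ) = 1 / 3 * (1 / 3) * (1 / 3) := by norm_num
      _ ≤ _ := by gcongr
  · rw [hl1, hl2, hl3]; push_cast; rfl
  · have : (1 : ℝ) ≤ q₁ * q₂ := by nlinarith
    nlinarith [mul_nonneg (by linarith : (0 : ℝ) ≤ q₁ * q₂ - 1) (by linarith : (0 : ℝ) ≤ q₁ * q₂)]
  · rw [norm_mul, norm_mul]
    gcongr
    · exact norm_LFunction_le_five_mul h1 hz hz'
    · exact norm_LFunction_le_five_mul h2 hz hz'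
    · have := norm_LFunction_le_five_mul h3 hz hz'
      push_cast at this
      exact this
  · simp [h0]

end DirichletCharacter

namespace DirichletCharacter

theorem norm_LFunction_one_le {q : ℕ} [NeZero q] {χ : DirichletCharacter ℂ q} (hχ : χ ≠ 1) {θ : ℝ}
    (hθ0 : 0 < θ) (hθ1 : θ ≤ 1) : ‖LFunction χ 1‖ ≤ (q : ℝ) ^ θ / θ := by
  have h := norm_LFunction_le hχ (s := 1) hθ0.le hθ1 (by simpa using hθ0)
  simpa using h

theorem exists_pos_le_norm_LFunction_one (q : ℕ) [NeZero q] :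
    ∃ c > 0, ∀ χ : DirichletCharacter ℂ q, χ ≠ 1 → c ≤ ‖LFunction χ 1‖ := by
  classical
  obtain ⟨χ₀, h₀⟩ := Finite.exists_min
    (fun χ : DirichletCharacter ℂ q => if χ = 1 then (1 : ℝ) else ‖LFunction χ 1‖)
  refine ⟨_, ?_, fun χ hχ => (h₀ χ).trans_eq (if_neg hχ)⟩
  split_ifs with h
  · exact one_pos
  · exact norm_pos_iff.mpr (LFunction_apply_one_ne_zero h)

/-- If `L(s, χ)` has no real zeros in `[β, 1)` then `ζ(β) L(β, χ) ≤ 0`. -/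
theorem riemannZeta_mul_LFunction_nonpos {q : ℕ} [NeZero q] {χ : DirichletCharacter ℂ q} (hχ : χ ≠ 1)
    (hχ2 : χ ^ 2 = 1) {β : ℝ} (hβ : 0 < β) (hβ1 : β < 1)
    (h : ∀ σ : ℝ, β ≤ σ → σ < 1 → LFunction χ σ ≠ 0) :
    (riemannZeta β * LFunction χ β).re ≤ 0 := by
  obtain ⟨x, hx, hx'⟩ := exists_riemannZeta_ofReal hβ hβ1.ne
  obtain ⟨y, hy, hy'⟩ := exists_LFunction_two hχ hχ2
  have hx0 : x ≤ 0 := hx.trans (div_nonpos_of_nonneg_of_nonpos hβ.le (by linarith))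
  rw [hx', Complex.re_ofReal_mul]
  refine mul_nonpos_of_nonpos_of_nonneg hx0 ?_
  by_contra! hneg
  have hcont : Continuous fun σ : ℝ => (LFunction χ σ).re :=
    Complex.continuous_re.comp ((differentiable_LFunction hχ).continuous.comp Complex.continuous_ofReal)
  have h2 : (LFunction χ (2 : ℝ)).re = y := by
    rw [Complex.ofReal_ofNat, hy', Complex.ofReal_re]
  obtain ⟨σ, hσ, hσ0⟩ := intermediate_value_Icc (by linarith : β ≤ 2) hcont.continuousOn
    (show (0 : ℝ) ∈ _ from ⟨hneg.le, by rw [h2]; linarith⟩)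
  have h0 : LFunction χ σ = 0 :=
    Complex.ext (by simpa using hσ0) (by simpa using LFunction_ofReal_im hχ hχ2 (hβ.trans_le hσ.1))
  rcases lt_or_ge σ 1 with h1 | h1
  · exact h σ hσ.1 h1 h0
  · exact LFunction_ne_zero_of_one_le_re χ (.inl hχ) (by simpa using h1) h0

/-- **Siegel's theorem**: a lower bound for `L(1, χ)` for real primitive characters. -/
theorem exists_mul_rpow_le_norm_LFunction_one {ε : ℝ} (hε : 0 < ε) (hε1 : ε ≤ 1) :
    ∃ c > 0, ∀ (q : ℕ) [NeZero q] (χ : DirichletCharacter ℂ q), χ ≠ 1 → χ ^ 2 = 1 → χ.IsPrimitive →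
      c * (q : ℝ) ^ (-ε) ≤ ‖LFunction χ 1‖ := by
  by_cases hz : ∃ (q₁ : ℕ) (_ : NeZero q₁) (χ₁ : DirichletCharacter ℂ q₁) (β : ℝ), χ₁ ≠ 1 ∧
      χ₁ ^ 2 = 1 ∧ χ₁.IsPrimitive ∧ 1 - ε / 24 ≤ β ∧ β < 1 ∧ LFunction χ₁ β = 0
  · obtain ⟨q₁, _, χ₁, β, h1, h1', hp1, hβ, hβ1, h0⟩ := hz
    obtain ⟨c₁, hc₁, hc₁'⟩ := exists_pos_le_norm_LFunction_one q₁
    have hq₁ : (1 : ℝ) ≤ q₁ := by exact_mod_cast NeZero.one_le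
    set B : ℝ := (q₁ : ℝ) ^ (ε / 2) / (ε / 2) with hB
    have hBpos : 0 < B := by positivity
    set c₂ : ℝ := (1 - β) / 54 * Real.exp (-((6 * Real.log (500000 * (q₁ : ℝ) ^ 2) + 1) *
      (1 - β))) / (B * B) with hc₂
    have hc₂pos : 0 < c₂ := div_pos (mul_pos (by linarith) (Real.exp_pos _)) (by positivity)
    refine ⟨min c₁ c₂, lt_min hc₁ hc₂pos, fun q _ χ hχ hχ2 hp => ?_⟩
    have hq : (1 : ℝ) ≤ q := by exact_mod_cast NeZero.one_le
    by_cases h3 : mulLevel χ₁ χ = 1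
    · obtain rfl := eq_of_mulLevel_eq_one hχ2 hp1 hp h3
      calc min c₁ c₂ * (q₁ : ℝ) ^ (-ε) ≤ c₁ * 1 := by
            gcongr
            · exact min_le_left _ _
            · exact Real.rpow_le_one_of_one_le_of_nonpos hq (by linarith)
        _ ≤ _ := by simpa using hc₁' χ hχ
    · have h := le_LFunction_one_of_zero h1 hχ h3 h1' hχ2 (by linarith) hβ1 h0
      have hL1 := norm_LFunction_one_le h1 (half_pos hε) (by linarith)
      have hL3 := norm_LFunction_one_le h3 (half_pos hε) (by linarith)
      rw [Nat.cast_mul, Real.mul_rpow (by positivity) (by positivity), mul_div_right_comm] at hL3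
      have hup : ‖LFunction χ₁ 1‖ * ‖LFunction χ 1‖ * ‖LFunction (mulLevel χ₁ χ) 1‖ ≤
          B * ‖LFunction χ 1‖ * (B * (q : ℝ) ^ (ε / 2)) := by gcongr
      have hlow : c₂ * (B * B) * (q : ℝ) ^ (-(ε / 2)) ≤ (1 - β) / 54 * Real.exp (-((6 * Real.log
          (4000 * ((5 * q₁) * (5 * q) * (5 * (q₁ * q)))) + 1) * (1 - β))) := by
        rw [hc₂, div_mul_cancel₀ _ (by positivity), mul_assoc]
        refine mul_le_mul_of_nonneg_left ?_ (by linarith)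
        rw [Real.rpow_def_of_pos (by positivity), ← Real.exp_add, Real.exp_le_exp]
        have : Real.log (4000 * ((5 * q₁) * (5 * q) * (5 * (q₁ * q)))) =
            Real.log (500000 * (q₁ : ℝ) ^ 2) + 2 * Real.log q := by
          rw [show (4000 * ((5 * q₁) * (5 * q) * (5 * (q₁ * q))) : ℝ) =
            500000 * (q₁ : ℝ) ^ 2 * (q : ℝ) ^ 2 by ring, Real.log_mul (by positivity) (by positivity),
            Real.log_pow (n := 2) (x := (q : ℝ))]
          push_cast; ring
        rw [this]
        have := mul_le_mul_of_nonneg_left (show 12 * (1 - β) ≤ ε / 2 by linarith) (Real.log_nonneg hq)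
        linarith
      have hcomb := hlow.trans (h.trans hup)
      have hrp : (q : ℝ) ^ (-(ε / 2)) = (q : ℝ) ^ (-ε) * (q : ℝ) ^ (ε / 2) := by
        rw [← Real.rpow_add (by positivity)]; congr 1; ring
      rw [hrp] at hcomb
      have hQ : 0 < (q : ℝ) ^ (ε / 2) := by positivity
      have : c₂ * (q : ℝ) ^ (-ε) ≤ ‖LFunction χ 1‖ := by
        refine le_of_mul_le_mul_right (le_of_eq_of_le ?_ (hcomb.trans_eq ?_))
          (by positivity : 0 < B * B * (q : ℝ) ^ (ε / 2)) <;> ring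
      refine le_trans ?_ this
      gcongr
      exact min_le_right _ _
  · push Not at hz
    refine ⟨ε / 24 / 54 * Real.exp (-((6 * Real.log 20000 + 1) * (ε / 24))), by positivity,
      fun q _ χ hχ hχ2 hp => ?_⟩
    have hq : (1 : ℝ) ≤ q := by exact_mod_cast NeZero.one_le
    have h := le_LFunction_one_of_nonpos hχ hχ2 (β := 1 - ε / 24) (by linarith) (by linarith)
      (riemannZeta_mul_LFunction_nonpos hχ hχ2 (by linarith) (by linarith)
        fun σ h1 h2 => hz q _ χ σ hχ hχ2 hp h1 h2)
    refine le_trans ?_ h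
    rw [sub_sub_cancel, mul_assoc]
    refine mul_le_mul_of_nonneg_left ?_ (by positivity)
    rw [Real.rpow_def_of_pos (by positivity), ← Real.exp_add, Real.exp_le_exp,
      ← mul_assoc, Real.log_mul (by norm_num) (by positivity)]
    norm_num
    nlinarith [Real.log_nonneg hq]

/-- Zeros of real primitive `L`-functions keep away from `1`. -/
theorem exists_le_norm_sub_one_of_LFunction_eq_zero {ε : ℝ} (hε : 0 < ε) (hε1 : ε ≤ 1) :
    ∃ c > 0, ∀ (q : ℕ) [NeZero q] (χ : DirichletCharacter ℂ q), χ ≠ 1 → χ ^ 2 = 1 → χ.IsPrimitive →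
      ∀ ρ : ℂ, LFunction χ ρ = 0 → c * (q : ℝ) ^ (-(2 * ε)) ≤ ‖ρ - 1‖ := by
  obtain ⟨c, hc, hS⟩ := exists_mul_rpow_le_norm_LFunction_one hε hε1
  refine ⟨min (ε / 4) (c * (ε ^ 2 / 16)), by positivity, fun q _ χ hχ hχ2 hp ρ hρ => ?_⟩
  have hq : (1 : ℝ) ≤ q := by exact_mod_cast NeZero.one_le
  rcases lt_or_ge (ε / 4) ‖ρ - 1‖ with hfar | hnear
  · refine le_trans ?_ hfar.le
    calc min (ε / 4) (c * (ε ^ 2 / 16)) * (q : ℝ) ^ (-(2 * ε)) ≤ ε / 4 * 1 := by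
          gcongr
          · exact min_le_left _ _
          · exact Real.rpow_le_one_of_one_le_of_nonpos hq (by linarith)
      _ = _ := mul_one _
  · have hderiv : ∀ s ∈ Metric.closedBall (1 : ℂ) (ε / 4),
        ‖deriv (LFunction χ) s‖ ≤ 16 / ε ^ 2 * (q : ℝ) ^ ε := by
      intro s hs
      have := Complex.norm_deriv_le_of_forall_mem_sphere_norm_le (c := s) (by positivity : 0 < ε / 4)
        (differentiable_LFunction hχ).diffContOnCl (C := 4 / ε * (q : ℝ) ^ ε) ?_
      · refine this.trans_eq ?_
        field_simp
        norm_num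
      · intro z hz
        rw [mem_sphere_iff_norm] at hz
        rw [mem_closedBall_iff_norm] at hs
        have hz1 : ‖z - 1‖ ≤ ε / 2 := by
          calc ‖z - 1‖ = ‖(z - s) + (s - 1)‖ := by ring_nf
            _ ≤ _ := norm_add_le _ _
            _ ≤ _ := by linarith
        have hre : 1 - ε / 2 ≤ z.re := by
          have := (Complex.abs_re_le_norm (z - 1)).trans hz1
          rw [Complex.sub_re, Complex.one_re, abs_le] at this
          linarith
        have hz2 : ‖z‖ ≤ 2 := by
          calc ‖z‖ = ‖(z - 1) + 1‖ := by ring_nf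
            _ ≤ ‖z - 1‖ + ‖(1 : ℂ)‖ := norm_add_le _ _
            _ ≤ _ := by rw [norm_one]; linarith
        refine (norm_LFunction_le hχ hε.le hε1 (by linarith)).trans ?_
        have hpos : 0 < z.re - 1 + ε := by linarith
        calc ‖z‖ * ((q : ℝ) ^ ε / (z.re - 1 + ε)) ≤ 2 * ((q : ℝ) ^ ε / (ε / 2)) := by
              gcongr
              linarith
          _ = _ := by field_simp; norm_num
    have hmv := (convex_closedBall (1 : ℂ) (ε / 4)).norm_image_sub_le_of_norm_deriv_le
      (fun s _ => (differentiable_LFunction hχ) s) hderiv (mem_closedBall_iff_norm.mpr hnear)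
      (Metric.mem_closedBall_self (by positivity))
    rw [hρ, sub_zero, norm_sub_rev] at hmv
    have h1 := (hS q χ hχ hχ2 hp).trans hmv
    have hQ : 0 < (q : ℝ) ^ ε := by positivity
    have hrp : (q : ℝ) ^ (-ε) = (q : ℝ) ^ (-(2 * ε)) * (q : ℝ) ^ ε := by
      rw [← Real.rpow_add (by positivity)]; congr 1; ring
    rw [hrp] at h1
    have : c * (ε ^ 2 / 16) * (q : ℝ) ^ (-(2 * ε)) ≤ ‖ρ - 1‖ := by
      refine le_of_mul_le_mul_right (le_of_le_of_eq (mul_le_mul_of_nonneg_left h1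
        (by positivity : 0 ≤ ε ^ 2 / 16) |>.trans_eq' ?_) ?_) hQ
      · ring
      · field_simp
    refine le_trans ?_ this
    gcongr
    exact min_le_right _ _

end DirichletCharacter

namespace DirichletCharacter

/-- A zero-free region for primitive Dirichlet `L`-functions, with an ineffective constant. -/
theorem exists_zeroFree {ε : ℝ} (hε : 0 < ε) (hε1 : ε ≤ 1) :
    ∃ c > 0, c ≤ 1 ∧ ∀ (q : ℕ) [NeZero q] (χ : DirichletCharacter ℂ q), χ ≠ 1 → χ.IsPrimitive →
      ∀ β t : ℝ, LFunction χ (β + t * Complex.I) = 0 →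
        β < 1 - c * (q : ℝ) ^ (-(2 * ε)) / Real.log (|t| + 3) := by
  obtain ⟨c, hc, hS⟩ := exists_le_norm_sub_one_of_LFunction_eq_zero hε hε1
  set a : ℝ := min (ε / 8000) (c / 4) with ha
  have ha0 : 0 < a := by positivity
  have haε : a ≤ ε / 8000 := min_le_left _ _
  have hac : a ≤ c / 4 := min_le_right _ _
  refine ⟨a ^ 2 / 10, by positivity, by nlinarith, fun q _ χ hχ hp β t h0 => ?_⟩
  have hq : (1 : ℝ) ≤ q := by exact_mod_cast NeZero.one_le
  set T := Real.log (|t| + 3) with hT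
  have ht := abs_nonneg t
  have hT1 : 1 ≤ T := by
    rw [hT, Real.le_log_iff_exp_le (by positivity)]
    linarith [Real.exp_one_lt_d9]
  set Q := (q : ℝ) ^ (-(2 * ε)) with hQ
  have hQ0 : 0 < Q := by positivity
  have hQ1 : Q ≤ 1 := Real.rpow_le_one_of_one_le_of_nonpos hq (by linarith)
  set η := a ^ 2 * Q / T with hη
  have hη0 : 0 < η := by positivity
  have hηle : η ≤ a ^ 2 * Q := div_le_self (by positivity) hT1
  have hη1 : η ≤ 1 / 12 := by
    have : a ^ 2 * Q ≤ a ^ 2 * 1 := by gcongr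
    nlinarith
  have hgoal : a ^ 2 / 10 * Q / T = η / 10 := by rw [hη]; ring
  rw [hgoal]
  have hlog : η * Real.log (8 * q * (2 * |t| + 3) / η) ≤ 1 / 800 := by
    have hlq : Real.log q * Q ≤ 1 / (2 * ε) := by
      have h1 := Real.log_le_rpow_div (zero_le_one.trans hq) (by linarith : 0 < 2 * ε)
      have h2 : (q : ℝ) ^ (2 * ε) * Q = 1 := by
        rw [hQ, ← Real.rpow_add (by positivity)]; simp
      calc Real.log q * Q ≤ (q : ℝ) ^ (2 * ε) / (2 * ε) * Q := by gcongr
        _ = (q : ℝ) ^ (2 * ε) * Q / (2 * ε) := by ring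
        _ = _ := by rw [h2]
    have hla : Real.log a⁻¹ ≤ a⁻¹ := (Real.log_le_sub_one_of_pos (by positivity)).trans (by linarith)
    have hlT : Real.log T ≤ T := (Real.log_le_sub_one_of_pos (by positivity)).trans (by linarith)
    have hl8 : Real.log 8 ≤ 3 := by
      rw [show (8 : ℝ) = 2 ^ 3 by norm_num, Real.log_pow]
      have := Real.log_two_lt_d9
      push_cast; linarith
    have hl2t : Real.log (2 * |t| + 3) ≤ 2 * T := by
      rw [hT, show (2 : ℝ) = ((2 : ℕ) : ℝ) by norm_num, ← Real.log_pow]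
      push_cast
      exact Real.log_le_log (by positivity) (by nlinarith)
    have hlqinv : Real.log Q⁻¹ = 2 * ε * Real.log q := by
      rw [hQ, Real.log_inv, Real.log_rpow (by positivity)]; ring
    have hexp : Real.log (8 * q * (2 * |t| + 3) / η) = Real.log 8 + Real.log q +
        Real.log (2 * |t| + 3) + (2 * Real.log a⁻¹ + Real.log Q⁻¹ + Real.log T) := by
      rw [show 8 * q * (2 * |t| + 3) / η = 8 * q * (2 * |t| + 3) * (a⁻¹ ^ 2 * Q⁻¹ * T) by
        rw [hη]; field_simp]
      rw [Real.log_mul (by positivity) (by positivity), Real.log_mul (by positivity) (by positivity),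
        Real.log_mul (by positivity) (by positivity), Real.log_mul (by positivity) (by positivity),
        Real.log_mul (by positivity) (by positivity), Real.log_pow]
      push_cast; ring
    have hbound : Real.log (8 * q * (2 * |t| + 3) / η) ≤ 3 + 3 * Real.log q + 3 * T + 2 * a⁻¹ := by
      rw [hexp, hlqinv]
      nlinarith [Real.log_nonneg hq]
    have hbound' : Real.log (8 * q * (2 * |t| + 3) / η) ≤ T * (6 + 3 * Real.log q + 2 * a⁻¹) := by
      refine hbound.trans ?_
      have h1 := mul_le_mul_of_nonneg_right hT1 (by positivity : (0 : ℝ) ≤ 3 * Real.log q + 2 * a⁻¹)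
      linarith
    calc η * Real.log (8 * q * (2 * |t| + 3) / η)
        ≤ η * (T * (6 + 3 * Real.log q + 2 * a⁻¹)) := by gcongr
      _ = a ^ 2 * (6 * Q + 3 * (Real.log q * Q) + 2 * a⁻¹ * Q) := by
          rw [hη]; field_simp
      _ ≤ a ^ 2 * (6 * 1 + 3 * (1 / (2 * ε)) + 2 * a⁻¹ * 1) := by gcongr
      _ = 6 * a * a + 3 / 2 * a * (a / ε) + 2 * a := by field_simp
      _ ≤ 6 * a * 1 + 3 / 2 * a * 1 + 2 * a := by
          gcongr
          · linarith
          · rw [div_le_one hε]; linarith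
      _ ≤ 1 / 800 := by linarith
  by_cases h2 : χ ^ 2 ≠ 1 ∨ 2 * η ≤ |t|
  · exact lt_of_LFunction_eq_zero hχ hη0 hη1 hlog h2 h0
  · push Not at h2
    have hfar := hS q χ hχ h2.1 hp _ h0
    have hβ : β < 1 := by
      by_contra! hβ
      exact LFunction_ne_zero_of_one_le_re χ (.inl hχ) (by simpa using hβ) h0
    have htri : ‖(β + t * Complex.I : ℂ) - 1‖ ≤ (1 - β) + |t| := by
      refine (Complex.norm_le_abs_re_add_abs_im _).trans ?_
      simp only [Complex.sub_re, Complex.add_re, Complex.ofReal_re, Complex.mul_re, Complex.I_re,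
        Complex.ofReal_im, Complex.I_im, Complex.one_re, Complex.sub_im, Complex.add_im,
        Complex.mul_im, Complex.one_im]
      rw [abs_sub_comm, abs_of_pos (by linarith)]
      simp
    have : 4 * η ≤ c * Q := by
      have h1 : a ^ 2 ≤ a * 1 := by rw [sq]; gcongr; linarith
      nlinarith
    linarith [h2.2]

/-- Bounds for the derivatives of `L'/L` just to the right of the line `Re s = 1`. -/
theorem exists_norm_iteratedDeriv_logDeriv_LFunction_le {ε : ℝ} (hε : 0 < ε) (hε1 : ε ≤ 1) :
    ∃ D > 0, ∀ (q : ℕ) [NeZero q] (χ : DirichletCharacter ℂ q), χ ≠ 1 → χ.IsPrimitive →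
      ∀ δ t : ℝ, 0 < δ → δ ≤ 1 → ∀ k : ℕ,
        ‖iteratedDeriv k (logDeriv (LFunction χ)) (1 + δ + t * Complex.I)‖ ≤
          ((k + 1).factorial : ℝ) ^ 2 * (D * (q : ℝ) ^ (2 * ε)) ^ (k + 1) * (24 * (q / δ)) *
            (|t| + 3) ^ (1 / 2 : ℝ) := by
  obtain ⟨c, hc, hc1, hS⟩ := exists_zeroFree hε hε1
  refine ⟨16 / c, by positivity, fun q _ χ hχ hp δ t hδ hδ1 k => ?_⟩
  have hq : (1 : ℝ) ≤ q := by exact_mod_cast NeZero.one_le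
  set T := Real.log (|t| + 3) with hT
  have ht := abs_nonneg t
  have hT1 : 1 ≤ T := by
    rw [hT, Real.le_log_iff_exp_le (by positivity)]
    linarith [Real.exp_one_lt_d9]
  have hT4 : Real.log (|t| + 4) ≤ 2 * T := by
    rw [hT, show (2 : ℝ) = ((2 : ℕ) : ℝ) by norm_num, ← Real.log_pow]
    exact Real.log_le_log (by positivity) (by nlinarith)
  set Q := (q : ℝ) ^ (2 * ε) with hQ
  have hQ1 : 1 ≤ Q := Real.one_le_rpow hq (by positivity)
  set r := c / (2 * T * Q) with hr
  have hr0 : 0 < r := by positivity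
  have hr1 : r ≤ 1 / 2 := by
    rw [hr, div_le_iff₀ (by positivity)]
    nlinarith [one_le_mul_of_one_le_of_one_le hT1 hQ1]
  have hzf : ∀ z ∈ Metric.ball (1 + δ + t * Complex.I : ℂ) r, LFunction χ z ≠ 0 := by
    intro z hz h0
    rw [mem_ball_iff_norm] at hz
    have hre := (Complex.abs_re_le_norm _).trans_lt hz
    have him := (Complex.abs_im_le_norm _).trans_lt hz
    simp only [Complex.sub_re, Complex.add_re, Complex.ofReal_re, Complex.mul_re, Complex.I_re,
        Complex.ofReal_im, Complex.I_im, Complex.one_re, Complex.sub_im, Complex.add_im,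
        Complex.mul_im, Complex.one_im] at hre him
    rw [abs_lt] at hre
    have himle : |z.im| ≤ |t| + 1 := by
      have h1 := abs_sub_abs_le_abs_sub z.im t
      have h2 : |z.im - t| < r := by simpa using him
      linarith
    have h := hS q χ hχ hp z.re z.im (by rwa [Complex.re_add_im])
    have hlog : Real.log (|z.im| + 3) ≤ 2 * T :=
      (Real.log_le_log (by positivity) (by linarith)).trans hT4
    have hlog0 : 0 < Real.log (|z.im| + 3) := Real.log_pos (by linarith [abs_nonneg z.im])
    have : r ≤ c * (q : ℝ) ^ (-(2 * ε)) / Real.log (|z.im| + 3) := by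
      rw [Real.rpow_neg (by positivity), ← hQ, hr, ← div_eq_mul_inv, div_div, mul_comm (2 * T)]
      gcongr
    linarith [hre.1]
  have hM := log_const_pos (q := q) (t := t) hδ hδ1
  refine (norm_iteratedDeriv_logDeriv_le hr0 hM (differentiable_LFunction hχ).differentiableOn hzf
    (fun z hz => norm_LFunction_le_exp_mul hχ hδ hδ1
      (Metric.ball_subset_closedBall (Metric.ball_subset_ball hr1 hz))) k).trans ?_
  set u := |t| + 3 with hu
  have hu1 : 1 ≤ u := by linarith
  have hT4' : T ≤ 4 * u ^ (1 / 4 : ℝ) :=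
    (Real.log_le_rpow_div (by positivity) (by norm_num : (0 : ℝ) < 1 / 4)).trans_eq (by ring)
  have hMle : Real.log (8 * q * u / δ) ≤ 12 * (q / δ) * u ^ (1 / 4 : ℝ) := by
    have h1 : 1 ≤ q / δ := by rw [one_le_div hδ]; linarith
    have h2 : 1 ≤ u ^ (1 / 4 : ℝ) := Real.one_le_rpow hu1 (by norm_num)
    rw [show 8 * q * u / δ = 8 * (q / δ) * u by ring, Real.log_mul (by positivity) (by positivity)]
    have h3 : Real.log (8 * (q / δ)) ≤ 8 * (q / δ) :=
      (Real.log_le_sub_one_of_pos (by positivity)).trans (by linarith)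
    have h4 : 1 * u ^ (1 / 4 : ℝ) ≤ (q / δ) * u ^ (1 / 4 : ℝ) := by gcongr
    have h5 : (q / δ) * 1 ≤ (q / δ) * u ^ (1 / 4 : ℝ) := by gcongr
    linarith
  have hTk : T ^ (k + 1) ≤ (k + 1).factorial * 4 ^ (k + 1) * u ^ (1 / 4 : ℝ) := by
    have h1 := Real.pow_div_factorial_le_exp (T / 4) (by positivity) (k + 1)
    have h2 : Real.exp (T / 4) = u ^ (1 / 4 : ℝ) := by
      rw [Real.rpow_def_of_pos (by positivity), ← hT]; congr 1; ring
    rw [h2, div_pow, div_div, div_le_iff₀ (by positivity)] at h1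
    linarith
  have hru : (u ^ (1 / 4 : ℝ)) * u ^ (1 / 4 : ℝ) = u ^ (1 / 2 : ℝ) := by
    rw [← Real.rpow_add (by positivity)]; norm_num
  have hrk : 1 / (r / 2) ^ (k + 1) = (4 / c * Q) ^ (k + 1) * T ^ (k + 1) := by
    rw [← mul_pow, one_div, ← inv_pow, hr]
    congr 1
    field_simp
    norm_num
  calc ((k + 1).factorial : ℝ) * (2 * Real.log (8 * q * u / δ)) / (r / 2) ^ (k + 1)
      = (k + 1).factorial * (2 * Real.log (8 * q * u / δ)) *
          ((4 / c * Q) ^ (k + 1) * T ^ (k + 1)) := by rw [← hrk]; ring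
    _ ≤ (k + 1).factorial * (2 * (12 * (q / δ) * u ^ (1 / 4 : ℝ))) *
          ((4 / c * Q) ^ (k + 1) * ((k + 1).factorial * 4 ^ (k + 1) * u ^ (1 / 4 : ℝ))) := by
        gcongr
    _ = (k + 1).factorial ^ 2 * ((4 / c * Q) ^ (k + 1) * 4 ^ (k + 1)) * (24 * (q / δ)) *
          (u ^ (1 / 4 : ℝ) * u ^ (1 / 4 : ℝ)) := by ring
    _ = _ := by
        rw [hru, ← mul_pow]
        congr 4
        ring

end DirichletCharacter

section

open Complex MeasureTheory Set

namespace Perron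

/-- The kernel `1 / s - 1 / (s + 1)`, the Mellin transform of `max (1 - y) 0`. -/
noncomputable def kernel (s : ℂ) : ℂ := 1 / s - 1 / (s + 1)

theorem kernel_eq {s : ℂ} (hs : 0 < s.re) : kernel s = 1 / (s * (s + 1)) := by
  have h0 : s ≠ 0 := by rintro rfl; simp at hs
  have h1 : s + 1 ≠ 0 := by
    intro h
    have := congrArg re h
    simp at this
    linarith
  rw [kernel]
  field_simp
  ring

theorem hasMellin_one_sub {s : ℂ} (hs : 0 < s.re) :
    HasMellin (fun y : ℝ => indicator (Ioc (0 : ℝ) 1) (fun _ => (1 : ℂ)) y -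
      indicator (Ioc (0 : ℝ) 1) (fun t : ℝ => (t : ℂ) ^ (1 : ℂ)) y) s (kernel s) := by
  have h1 := hasMellin_one_Ioc hs
  have h2 := hasMellin_cpow_Ioc 1 (s := s) (by rw [one_re]; linarith)
  rw [kernel, ← h1.2, ← h2.2]
  exact hasMellin_sub h1.1 h2.1

theorem norm_kernel_le {c : ℝ} (hc : 1 ≤ c) (y : ℝ) : ‖kernel (c + y * I)‖ ≤ (1 + y ^ 2)⁻¹ := by
  rw [kernel_eq (by simp; linarith), norm_div, norm_one, one_div, norm_mul]
  have key : ∀ a : ℝ, 1 ≤ a → √(1 + y ^ 2) ≤ ‖(a + y * I : ℂ)‖ := by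
    intro a ha
    rw [norm_add_mul_I]
    exact Real.sqrt_le_sqrt (by nlinarith)
  have h1 := key c hc
  have h2 := key (c + 1) (by linarith)
  have h3 : (c : ℂ) + y * I + 1 = ((c + 1 : ℝ) : ℂ) + y * I := by push_cast; ring
  rw [h3]
  gcongr
  calc 1 + y ^ 2 = √(1 + y ^ 2) * √(1 + y ^ 2) := (Real.mul_self_sqrt (by positivity)).symm
    _ ≤ _ := by gcongr

theorem continuous_kernel {c : ℝ} (hc : 1 ≤ c) : Continuous fun y : ℝ => kernel (c + y * I) := by
  unfold kernel
  refine ((continuous_const.div (by fun_prop) ?_).sub (continuous_const.div (by fun_prop) ?_)) <;>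
  · intro y h
    have := congrArg re h
    simp at this
    linarith

theorem integrable_kernel {c : ℝ} (hc : 1 ≤ c) : Integrable fun y : ℝ => kernel (c + y * I) :=
  integrable_inv_one_add_sq.mono' (continuous_kernel hc).aestronglyMeasurable
    (.of_forall (norm_kernel_le hc))

theorem integral_cpow_mul_kernel {c : ℝ} (hc : 1 ≤ c) {x : ℝ} (hx : 0 < x) :
    ∫ y : ℝ, (x : ℂ) ^ (-(c + y * I)) * kernel (c + y * I) =
      (2 * Real.pi : ℝ) * (max (1 - x) 0 : ℝ) := by
  set f : ℝ → ℂ := fun y : ℝ => indicator (Ioc (0 : ℝ) 1) (fun _ => (1 : ℂ)) y -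
      indicator (Ioc (0 : ℝ) 1) (fun t : ℝ => (t : ℂ) ^ (1 : ℂ)) y with hf
  have hfx : ∀ y : ℝ, 0 < y → f y = (max (1 - y) 0 : ℝ) := by
    intro y hy
    by_cases h1 : y ≤ 1
    · rw [hf]
      simp only [indicator_of_mem (show y ∈ Ioc (0 : ℝ) 1 from ⟨hy, h1⟩), cpow_one]
      rw [max_eq_left (by linarith)]
      push_cast; ring
    · rw [hf]
      simp only [indicator_of_notMem (show y ∉ Ioc (0 : ℝ) 1 from fun h => h1 h.2)]
      rw [max_eq_right (by linarith)]
      simp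
  have hre : ∀ y : ℝ, 0 < (c + y * I : ℂ).re := fun y => by simp; linarith
  have hmel : ∀ y : ℝ, mellin f (c + y * I) = kernel (c + y * I) :=
    fun y => (hasMellin_one_sub (hre y)).2
  have hconv : MellinConvergent f c := (hasMellin_one_sub (s := (c : ℂ)) (by simp; linarith)).1
  have hvert : VerticalIntegrable (mellin f) c := by
    unfold VerticalIntegrable
    simp_rw [hmel]
    exact integrable_kernel hc
  have hcont : ContinuousAt f x := by
    have : ContinuousAt (fun y : ℝ => ((max (1 - y) 0 : ℝ) : ℂ)) x := by
      refine Continuous.continuousAt ?_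
      fun_prop
    refine this.congr ?_
    filter_upwards [lt_mem_nhds hx] with y hy using (hfx y hy).symm
  have h := mellinInv_mellin_eq c f hx hconv hvert hcont
  rw [mellinInv, hfx x hx] at h
  simp_rw [hmel, smul_eq_mul] at h
  rw [← h, Complex.real_smul, ← mul_assoc, ← Complex.ofReal_mul, mul_one_div_cancel (by positivity),
    Complex.ofReal_one, one_mul]

/-- Weighted Perron formula for a Dirichlet series, on a line of absolute convergence. -/
theorem two_pi_mul_sum_eq_integral {b : ℕ → ℂ} {c : ℝ} (hc : 1 ≤ c) (hb : LSeriesSummable b c) {x : ℝ}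
    (hx : 0 < x) : (2 * Real.pi : ℝ) * ∑ n ∈ Finset.Ioc 0 ⌊x⌋₊, b n * (1 - n / x) =
      ∫ y : ℝ, LSeries b (c + y * I) * (x : ℂ) ^ (c + y * I : ℂ) * kernel (c + y * I) := by
  have hx0 : (x : ℂ) ≠ 0 := by exact_mod_cast hx.ne'
  set F : ℕ → ℝ → ℂ := fun n y =>
    LSeries.term b (c + y * I) n * (x : ℂ) ^ (c + y * I : ℂ) * kernel (c + y * I) with hF
  have hFeq : ∀ n : ℕ, n ≠ 0 → ∀ y : ℝ, F n y =
      b n * (((n / x : ℝ) : ℂ) ^ (-(c + y * I : ℂ)) * kernel (c + y * I)) := by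
    intro n hn y
    rw [hF]
    dsimp only
    rw [LSeries.term_of_ne_zero hn, Complex.ofReal_div,
      Complex.div_cpow_ofReal_nonneg (Nat.cast_nonneg n) hx.le, Complex.ofReal_natCast, cpow_neg,
      cpow_neg]
    field_simp
  have hnorm : ∀ n y, ‖F n y‖ = ‖LSeries.term b c n‖ * x ^ c * ‖kernel (c + y * I)‖ := by
    intro n y
    rw [hF]
    dsimp only
    rw [norm_mul, norm_mul, LSeries.norm_term_eq, LSeries.norm_term_eq, norm_cpow_eq_rpow_re_of_pos hx]
    simp
  have hFint : ∀ n, Integrable (F n) := by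
    intro n
    have hm : AEStronglyMeasurable (F n) volume := by
      refine Continuous.aestronglyMeasurable ?_
      rcases eq_or_ne n 0 with rfl | hn
      · simp only [hF, LSeries.term_zero, zero_mul]
        exact continuous_const
      · have := funext (hFeq n hn)
        rw [this]
        have hn0 : (((n / x : ℝ) : ℂ)) ≠ 0 := by
          exact_mod_cast div_ne_zero (by exact_mod_cast hn) hx.ne'
        refine continuous_const.mul (Continuous.mul ?_ (continuous_kernel hc))
        exact Continuous.const_cpow (by fun_prop) (.inl hn0)
    refine ((integrable_kernel hc).norm.const_mul (‖LSeries.term b c n‖ * x ^ c)).mono' hm ?_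
    exact .of_forall fun y => (hnorm n y).le
  have hsum : Summable fun n => ∫ y, ‖F n y‖ := by
    simp_rw [hnorm, integral_const_mul]
    exact (hb.norm.mul_right _).mul_right _
  have h := hasSum_integral_of_summable_integral_norm hFint hsum
  have hR : (fun y => ∑' n, F n y) = fun y : ℝ =>
      LSeries b (c + y * I) * (x : ℂ) ^ (c + y * I : ℂ) * kernel (c + y * I) := by
    funext y
    rw [hF]
    simp_rw [tsum_mul_right]
    rfl
  rw [hR] at h
  have hFint : ∀ n : ℕ, n ≠ 0 →
      ∫ y, F n y = b n * ((2 * Real.pi : ℝ) * (max (1 - n / x) 0 : ℝ)) := by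
    intro n hn
    rw [funext (hFeq n hn), integral_const_mul, integral_cpow_mul_kernel hc (by positivity)]
  have hfin : HasSum (fun n => ∫ y, F n y) (∑ n ∈ Finset.Ioc 0 ⌊x⌋₊, ∫ y, F n y) := by
    refine hasSum_sum_of_ne_finset_zero fun n hn => ?_
    rcases eq_or_ne n 0 with rfl | hn0
    · simp [hF]
    · rw [hFint n hn0, max_eq_right]
      · simp
      · rw [Finset.mem_Ioc, not_and, not_le] at hn
        have := Nat.lt_of_floor_lt (hn (Nat.pos_of_ne_zero hn0))
        rw [sub_nonpos, one_le_div hx]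
        exact this.le
  rw [h.unique hfin, Finset.mul_sum]
  refine Finset.sum_congr rfl fun n hn => ?_
  rw [Finset.mem_Ioc] at hn
  have hnx : (n : ℝ) ≤ x := (Nat.le_floor_iff hx.le).mp hn.2
  rw [hFint n hn.1.ne', max_eq_left (by rw [sub_nonneg, div_le_one hx]; exact hnx)]
  push_cast
  ring

/-- A bound for smoothed sums of coefficients of a Dirichlet series of moderate growth. -/
theorem exists_norm_sum_le : ∃ J > 0, ∀ (b : ℕ → ℂ) (c : ℝ), 1 ≤ c → LSeriesSummable b c → ∀ M : ℝ,
    (∀ y : ℝ, ‖LSeries b (c + y * I)‖ ≤ M * (|y| + 3) ^ (1 / 2 : ℝ)) → ∀ x : ℝ, 0 < x →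
      ‖∑ n ∈ Finset.Ioc 0 ⌊x⌋₊, b n * (x - n)‖ ≤ J * M * x ^ (c + 1) := by
  have hI : Integrable (fun y : ℝ => (1 + ‖y‖) ^ (-(3 / 2 : ℝ))) :=
    integrable_one_add_norm (by simp; norm_num)
  set J := ∫ y : ℝ, (1 + ‖y‖) ^ (-(3 / 2 : ℝ)) with hJ
  have hJ0 : 0 ≤ J := integral_nonneg fun y => by positivity
  refine ⟨4 * J + 1, by positivity, fun b c hc hb M hM x hx => ?_⟩
  have hM0 : 0 ≤ M := by
    have := (norm_nonneg _).trans (hM 0)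
    exact nonneg_of_mul_nonneg_left this (by positivity)
  have hbound : ∀ y : ℝ, ‖LSeries b (c + y * I) * (x : ℂ) ^ (c + y * I : ℂ) * kernel (c + y * I)‖ ≤
      4 * M * x ^ c * (1 + ‖y‖) ^ (-(3 / 2 : ℝ)) := by
    intro y
    have hy := abs_nonneg y
    rw [norm_mul, norm_mul, norm_cpow_eq_rpow_re_of_pos hx]
    have hre : (c + y * I : ℂ).re = c := by simp
    rw [hre, Real.norm_eq_abs]
    have h1 : (|y| + 3) ^ (1 / 2 : ℝ) ≤ 2 * (1 + |y|) ^ (1 / 2 : ℝ) := by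
      have h4 : (2 : ℝ) = 4 ^ (1 / 2 : ℝ) := by
        rw [← Real.sqrt_eq_rpow, show (4 : ℝ) = 2 ^ 2 by norm_num, Real.sqrt_sq (by norm_num)]
      refine le_of_le_of_eq ?_ (congrArg (· * (1 + |y|) ^ (1 / 2 : ℝ)) h4.symm)
      rw [← Real.mul_rpow (by norm_num) (by positivity)]
      exact Real.rpow_le_rpow (by positivity) (by linarith) (by norm_num)
    have h2 : (1 + y ^ 2)⁻¹ ≤ 2 * (1 + |y|) ^ (-2 : ℝ) := by
      rw [Real.rpow_neg (by positivity), Real.rpow_two, ← div_eq_mul_inv, ← one_div,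
        div_le_div_iff₀ (by positivity) (by positivity), ← sq_abs y]
      nlinarith [sq_nonneg (|y| - 1)]
    have h3 : (1 + |y|) ^ (1 / 2 : ℝ) * (1 + |y|) ^ (-2 : ℝ) = (1 + |y|) ^ (-(3 / 2 : ℝ)) := by
      rw [← Real.rpow_add (by positivity)]; norm_num
    calc ‖LSeries b (c + y * I)‖ * x ^ c * ‖kernel (c + y * I)‖
        ≤ M * (2 * (1 + |y|) ^ (1 / 2 : ℝ)) * x ^ c * (2 * (1 + |y|) ^ (-2 : ℝ)) := by
          gcongr
          · exact (hM y).trans (by gcongr)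
          · exact (norm_kernel_le hc y).trans h2
      _ = 4 * M * x ^ c * ((1 + |y|) ^ (1 / 2 : ℝ) * (1 + |y|) ^ (-2 : ℝ)) := by ring
      _ = _ := by rw [h3]
  have h := norm_integral_le_of_norm_le (hI.const_mul _) (.of_forall hbound)
  rw [← two_pi_mul_sum_eq_integral hc hb hx, integral_const_mul, ← hJ, norm_mul, Complex.norm_real,
    Real.norm_of_nonneg (by positivity)] at h
  have hS : ∑ n ∈ Finset.Ioc 0 ⌊x⌋₊, b n * (x - n) =
      x * ∑ n ∈ Finset.Ioc 0 ⌊x⌋₊, b n * (1 - n / x) := by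
    rw [Finset.mul_sum]
    refine Finset.sum_congr rfl fun n _ => ?_
    have hx0 : (x : ℂ) ≠ 0 := by exact_mod_cast hx.ne'
    field_simp
  rw [hS, norm_mul, Complex.norm_real, Real.norm_of_nonneg hx.le]
  have h1 : ‖∑ n ∈ Finset.Ioc 0 ⌊x⌋₊, b n * (1 - n / x)‖ ≤ 4 * M * x ^ c * J := by
    refine le_trans ?_ h
    refine le_mul_of_one_le_left (norm_nonneg _) ?_
    linarith [Real.pi_gt_three]
  calc x * ‖∑ n ∈ Finset.Ioc 0 ⌊x⌋₊, b n * (1 - n / x)‖ ≤ x * (4 * M * x ^ c * J) := by gcongr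
    _ = 4 * J * M * x ^ (c + 1) := by rw [Real.rpow_add_one hx.ne']; ring
    _ ≤ _ := by gcongr; linarith

end Perron

end

section

open Complex

theorem norm_sum_le_of_smoothed {b : ℕ → ℂ} {x h A R : ℝ} (hx : 0 ≤ x) (hh : 1 ≤ h)
    (h1 : ‖∑ n ∈ Finset.Ioc 0 ⌊x⌋₊, b n * (x - n)‖ ≤ A)
    (h2 : ‖∑ n ∈ Finset.Ioc 0 ⌊x + h⌋₊, b n * ((x + h : ℝ) - n)‖ ≤ A)
    (hR : ∀ n : ℕ, n ≤ x + h → ‖b n‖ ≤ R) :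
    ‖∑ n ∈ Finset.Ioc 0 ⌊x⌋₊, b n‖ ≤ 2 * A / h + 2 * h * R := by
  have hR0 : 0 ≤ R := (norm_nonneg _).trans (hR 0 (by push_cast; linarith))
  have hfl : ⌊x⌋₊ ≤ ⌊x + h⌋₊ := Nat.floor_mono (by linarith)
  have hsplit := Finset.sum_Ioc_consecutive (fun n => b n * ((x + h : ℝ) - n)) (Nat.zero_le _) hfl
  have hmain : h * ∑ n ∈ Finset.Ioc 0 ⌊x⌋₊, b n =
      ∑ n ∈ Finset.Ioc 0 ⌊x + h⌋₊, b n * ((x + h : ℝ) - n) -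
      ∑ n ∈ Finset.Ioc 0 ⌊x⌋₊, b n * (x - n) -
      ∑ n ∈ Finset.Ioc ⌊x⌋₊ ⌊x + h⌋₊, b n * ((x + h : ℝ) - n) := by
    rw [← hsplit, add_sub_right_comm, add_sub_cancel_right, ← Finset.sum_sub_distrib, Finset.mul_sum]
    refine Finset.sum_congr rfl fun n _ => ?_
    push_cast
    ring
  have htail : ‖∑ n ∈ Finset.Ioc ⌊x⌋₊ ⌊x + h⌋₊, b n * ((x + h : ℝ) - n)‖ ≤ 2 * h * (R * h) := by
    refine (norm_sum_le_of_le (f := fun n => b n * (((x + h : ℝ) : ℂ) - n)) _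
      (n := fun _ => R * h) ?_).trans ?_
    · intro n hn
      rw [Finset.mem_Ioc] at hn
      have hn1 : x < n := Nat.lt_of_floor_lt hn.1
      have hn2 : (n : ℝ) ≤ x + h := (Nat.le_floor_iff (by linarith)).mp hn.2
      rw [norm_mul]
      refine mul_le_mul (hR n hn2) ?_ (norm_nonneg _) hR0
      rw [← ofReal_natCast, ← ofReal_sub, norm_real, Real.norm_of_nonneg (by linarith)]
      linarith
    · rw [Finset.sum_const, Nat.card_Ioc, nsmul_eq_mul]
      gcongr
      rw [Nat.cast_sub hfl]
      linarith [Nat.floor_le (by linarith : 0 ≤ x + h), Nat.lt_floor_add_one x]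
  have hfin : h * ‖∑ n ∈ Finset.Ioc 0 ⌊x⌋₊, b n‖ ≤ A + A + 2 * h * (R * h) := by
    rw [← Real.norm_of_nonneg (by linarith : 0 ≤ h), ← norm_real, ← norm_mul, hmain]
    rw [norm_real, Real.norm_of_nonneg (by linarith : 0 ≤ h)]
    exact (norm_sub_le _ _).trans (add_le_add ((norm_sub_le _ _).trans (add_le_add h2 h1)) htail)
  have hh0 : 0 < h := by linarith
  calc ‖∑ n ∈ Finset.Ioc 0 ⌊x⌋₊, b n‖ ≤ (A + A + 2 * h * (R * h)) / h := by
        rw [le_div_iff₀ hh0, mul_comm]; exact hfin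
    _ = _ := by field_simp; ring

namespace DirichletCharacter

/-- The coefficients `χ(n) Λ(n) (log n) ^ k`. -/
noncomputable def vonMangoldtLogPow {q : ℕ} (χ : DirichletCharacter ℂ q) (k : ℕ) (n : ℕ) : ℂ :=
  (Real.log n : ℂ) ^ k * (χ (n : ZMod q) * (ArithmeticFunction.vonMangoldt n : ℂ))

variable {q : ℕ}

theorem vonMangoldtLogPow_eq (χ : DirichletCharacter ℂ q) (k : ℕ) : vonMangoldtLogPow χ k =
    LSeries.logMul^[k] ((fun n : ℕ => (χ n : ℂ)) * fun n => (ArithmeticFunction.vonMangoldt n : ℂ)) := by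
  induction k with
  | zero => ext n; simp [vonMangoldtLogPow]
  | succ k ih =>
    rw [Function.iterate_succ_apply', ← ih]
    ext n
    rw [LSeries.logMul, vonMangoldtLogPow, vonMangoldtLogPow, ← Complex.natCast_log]
    ring

theorem norm_vonMangoldtLogPow_le (χ : DirichletCharacter ℂ q) (k : ℕ) {n : ℕ} {y : ℝ} (hy : 1 ≤ y)
    (hn : n ≤ y) : ‖vonMangoldtLogPow χ k n‖ ≤ Real.log y ^ (k + 1) := by
  rcases Nat.eq_zero_or_pos n with rfl | hn0
  · simp only [vonMangoldtLogPow, ArithmeticFunction.map_zero, ofReal_zero, mul_zero, norm_zero]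
    exact pow_nonneg (Real.log_nonneg hy) _
  have hn1 : (1 : ℝ) ≤ n := by exact_mod_cast hn0
  have hlog : Real.log n ≤ Real.log y := Real.log_le_log (by linarith) hn
  have hlog0 := Real.log_nonneg hn1
  rw [vonMangoldtLogPow, norm_mul, norm_mul, norm_pow, norm_real, norm_real,
    Real.norm_of_nonneg hlog0, Real.norm_of_nonneg ArithmeticFunction.vonMangoldt_nonneg, pow_succ]
  refine mul_le_mul (pow_le_pow_left₀ hlog0 hlog k) ?_
    (mul_nonneg (norm_nonneg _) ArithmeticFunction.vonMangoldt_nonneg)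
    (pow_nonneg (hlog0.trans hlog) k)
  calc ‖χ n‖ * ArithmeticFunction.vonMangoldt n ≤ 1 * Real.log n := by
        gcongr
        · exact χ.norm_le_one _
        · exact ArithmeticFunction.vonMangoldt_le_log
    _ ≤ _ := by rwa [one_mul]

open ArithmeticFunction in
theorem abscissaOfAbsConv_lt (χ : DirichletCharacter ℂ q) {σ : ℝ} (hσ : 1 < σ) :
    LSeries.abscissaOfAbsConv ((fun n : ℕ => (χ n : ℂ)) * (fun n : ℕ => (Λ n : ℂ))) < σ := by
  obtain ⟨τ, h1, h2⟩ := exists_between hσ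
  exact (LSeriesSummable.abscissaOfAbsConv_le
    (LSeriesSummable_twist_vonMangoldt χ (s := (τ : ℂ)) (by simpa using h1))).trans_lt
    (by simpa using h2)

theorem LSeriesSummable_vonMangoldtLogPow (χ : DirichletCharacter ℂ q) (k : ℕ) {σ : ℝ} (hσ : 1 < σ) :
    LSeriesSummable (vonMangoldtLogPow χ k) σ := by
  rw [vonMangoldtLogPow_eq]
  apply LSeriesSummable_of_abscissaOfAbsConv_lt_re
  rw [LSeries.absicssaOfAbsConv_logPowMul]
  exact abscissaOfAbsConv_lt χ (by simpa using hσ)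

variable [NeZero q]

open ArithmeticFunction in
theorem norm_LSeries_vonMangoldtLogPow (χ : DirichletCharacter ℂ q) (k : ℕ) {s : ℂ} (hs : 1 < s.re) :
    ‖LSeries (vonMangoldtLogPow χ k) s‖ = ‖iteratedDeriv k (logDeriv (LFunction χ)) s‖ := by
  have h1 := LSeries_iteratedDeriv k (abscissaOfAbsConv_lt χ hs)
  have h2 : LSeries ((fun n : ℕ => (χ n : ℂ)) * (fun n : ℕ => (Λ n : ℂ))) =ᶠ[nhds s] fun z => -logDeriv (LFunction χ) z := by
    filter_upwards [(isOpen_lt continuous_const continuous_re).mem_nhds hs] with z hz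
    exact LSeries_mul_vonMangoldt_eq_neg_logDeriv χ hz
  rw [h2.iteratedDeriv_eq] at h1
  have h3 := congrArg norm h1
  rw [norm_mul, norm_pow, norm_neg, norm_one, one_pow, one_mul] at h3
  rw [vonMangoldtLogPow_eq, ← h3]
  rw [show (fun z => -logDeriv (LFunction χ) z) = -logDeriv (LFunction χ) from rfl,
    iteratedDeriv_neg, norm_neg]

end DirichletCharacter

end

section

open Filter Topology

theorem tendsto_rpow_mul_exp_neg_rpow_third (s : ℝ) :
    Tendsto (fun L : ℝ => L ^ s * Real.exp (-L ^ (1 / 3 : ℝ))) atTop (𝓝 0) := by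
  have h := (tendsto_rpow_mul_exp_neg_mul_atTop_nhds_zero (3 * s) 1 one_pos).comp
    (tendsto_rpow_atTop (by norm_num : (0 : ℝ) < 1 / 3))
  refine h.congr' ?_
  filter_upwards [eventually_gt_atTop 0] with L hL
  simp only [Function.comp_apply]
  rw [← Real.rpow_mul hL.le]
  ring_nf

theorem eventually_rpow_le_exp_rpow_third (s : ℝ) :
    ∀ᶠ L : ℝ in atTop, L ^ s ≤ Real.exp (L ^ (1 / 3 : ℝ)) := by
  filter_upwards [(tendsto_rpow_mul_exp_neg_rpow_third s).eventually (gt_mem_nhds one_pos)] with L hL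
  rw [Real.exp_neg, ← div_eq_mul_inv, div_lt_one (Real.exp_pos _)] at hL
  exact hL.le

namespace DirichletCharacter

theorem exists_norm_sum_vonMangoldtLogPow_mul_le {ε : ℝ} (hε : 0 < ε) (hε1 : ε ≤ 1) :
    ∃ D > 0, ∃ J > 0, ∀ (q : ℕ) [NeZero q] (χ : DirichletCharacter ℂ q), χ ≠ 1 → χ.IsPrimitive →
      ∀ (k : ℕ) (X x : ℝ), Real.exp 1 ≤ X → 0 < x → x ≤ 2 * X →
        ‖∑ n ∈ Finset.Ioc 0 ⌊x⌋₊, vonMangoldtLogPow χ k n * (x - n)‖ ≤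
          J * (((k + 1).factorial : ℝ) ^ 2 * (D * (q : ℝ) ^ (2 * ε)) ^ (k + 1) * (q * Real.log X)) *
            X ^ 2 := by
  obtain ⟨D, hD, hF⟩ := exists_norm_iteratedDeriv_logDeriv_LFunction_le hε hε1
  obtain ⟨J, hJ, hP⟩ := Perron.exists_norm_sum_le
  refine ⟨D, hD, 768 * J, by positivity, fun q _ χ hχ hp k X x hX hx hxX => ?_⟩
  have hX0 : 0 < X := (Real.exp_pos 1).trans_le hX
  have hX2 : 2 ≤ X := by linarith [Real.exp_one_gt_d9]
  have hL1 : 1 ≤ Real.log X := (Real.le_log_iff_exp_le hX0).mpr hX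
  set δ := 1 / Real.log X with hδ
  have hδ0 : 0 < δ := by positivity
  have hδ1 : δ ≤ 1 := by rw [hδ, div_le_one (by positivity)]; exact hL1
  have hqδ : (q : ℝ) / δ = q * Real.log X := by rw [hδ]; field_simp
  have h := hP (vonMangoldtLogPow χ k) (1 + δ) (by linarith)
    (LSeriesSummable_vonMangoldtLogPow χ k (by linarith))
    (((k + 1).factorial : ℝ) ^ 2 * (D * (q : ℝ) ^ (2 * ε)) ^ (k + 1) * (24 * (q / δ)))
    (fun y => by
      rw [norm_LSeries_vonMangoldtLogPow χ k (by simp; linarith)]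
      push_cast
      exact hF q χ hχ hp δ y hδ0 hδ1 k) x hx
  refine h.trans ?_
  rw [hqδ]
  have hxp : x ^ (1 + δ + 1) ≤ 32 * X ^ 2 := by
    have h1 : X ^ δ = Real.exp 1 := by
      rw [Real.rpow_def_of_pos hX0, hδ]
      congr 1
      field_simp
    calc x ^ (1 + δ + 1) ≤ (2 * X) ^ (1 + δ + 1) := by gcongr
      _ = (2 * X) ^ (2 : ℝ) * (2 * X) ^ δ := by
          rw [← Real.rpow_add (by positivity)]; congr 1; ring
      _ ≤ (2 * X) ^ (2 : ℝ) * (X * X) ^ δ := by gcongr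
      _ = 4 * X ^ 2 * (Real.exp 1 * Real.exp 1) := by
          rw [Real.mul_rpow hX0.le hX0.le, h1, Real.rpow_two]; ring
      _ ≤ 4 * X ^ 2 * (2.8 * 2.8) := by
          have := Real.exp_one_lt_d9
          gcongr <;> linarith
      _ ≤ _ := by nlinarith [sq_nonneg X]
  calc J * (((k + 1).factorial : ℝ) ^ 2 * (D * (q : ℝ) ^ (2 * ε)) ^ (k + 1) *
        (24 * (q * Real.log X))) * x ^ (1 + δ + 1)
      ≤ J * (((k + 1).factorial : ℝ) ^ 2 * (D * (q : ℝ) ^ (2 * ε)) ^ (k + 1) *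
        (24 * (q * Real.log X))) * (32 * X ^ 2) := by gcongr
    _ = _ := by ring

/-- A Siegel–Walfisz type bound for the sums of `χ(n) Λ(n) (log n) ^ k`, where `k` is about
`(log X) ^ (2 / 5)`. -/
theorem exists_norm_sum_vonMangoldtLogPow_le {C : ℝ} (hC : 0 < C) :
    ∃ K > 0, ∃ X₀ : ℝ, ∀ X : ℝ, X₀ ≤ X → ∀ (q : ℕ) [NeZero q] (χ : DirichletCharacter ℂ q), χ ≠ 1 →
      χ.IsPrimitive → (q : ℝ) ≤ Real.log X ^ C → ∀ x : ℝ, 0 < x → x ≤ X →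
        ‖∑ n ∈ Finset.Ioc 0 ⌊x⌋₊, vonMangoldtLogPow χ ⌊Real.log X ^ (2 / 5 : ℝ)⌋₊ n‖ ≤
          K * (Real.log X ^ ⌊Real.log X ^ (2 / 5 : ℝ)⌋₊ * X *
            (Real.log X ^ (-C) * Real.exp (-Real.log X ^ (1 / 3 : ℝ)))) := by
  set ε := min (1 / (20 * C)) 1 with hεdef
  have hε : 0 < ε := by positivity
  obtain ⟨D, hD, J, hJ, hB⟩ := exists_norm_sum_vonMangoldtLogPow_mul_le hε (min_le_right _ _)
  have hev : ∀ᶠ L : ℝ in atTop, 64 ≤ L ∧ L ^ (2 * C + 2) ≤ Real.exp (L ^ (1 / 3 : ℝ)) ∧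
      12 * D ≤ L ^ (1 / 10 : ℝ) ∧ 4 ≤ L ^ (1 / 15 : ℝ) :=
    (eventually_ge_atTop 64).and ((eventually_rpow_le_exp_rpow_third _).and
      (((tendsto_rpow_atTop (by norm_num)).eventually_ge_atTop _).and
        ((tendsto_rpow_atTop (by norm_num)).eventually_ge_atTop _)))
  obtain ⟨X₀, hX₀⟩ := eventually_atTop.mp (Real.tendsto_log_atTop.eventually hev)
  refine ⟨2 * J + 12, by positivity, max X₀ 1, fun X hX q _ χ hχ hp hq x hx hxX => ?_⟩
  obtain ⟨hL64, hLexp, hLD, hL15⟩ := hX₀ X ((le_max_left _ _).trans hX)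
  have hX0 : 0 < X := one_pos.trans_le ((le_max_right _ _).trans hX)
  set L := Real.log X with hL
  have hL0 : 0 < L := by linarith
  have hL1 : 1 ≤ L := by linarith
  set y := L ^ (1 / 3 : ℝ) with hy
  set k := ⌊L ^ (2 / 5 : ℝ)⌋₊ with hk
  have hq1 : (1 : ℝ) ≤ q := by exact_mod_cast NeZero.one_le
  have hXL : X = Real.exp L := (Real.exp_log hX0).symm
  have hy3 : y ^ 3 = L := by
    rw [hy, ← Real.rpow_natCast, ← Real.rpow_mul hL0.le]
    norm_num
  have hy4 : 4 ≤ y := by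
    refine le_of_pow_le_pow_left₀ three_ne_zero (by positivity) ?_
    rw [hy3]
    linarith
  have hy6 : 4 * y ≤ L ^ (2 / 5 : ℝ) := by
    have : L ^ (2 / 5 : ℝ) = L ^ (1 / 15 : ℝ) * y := by
      rw [hy, ← Real.rpow_add hL0]; norm_num
    rw [this]
    gcongr
  have hk1 : L ^ (2 / 5 : ℝ) ≤ (k + 1 : ℕ) := by
    push_cast
    exact (Nat.lt_floor_add_one _).le
  have hk2 : ((k + 1 : ℕ) : ℝ) ≤ 2 * L ^ (2 / 5 : ℝ) := by
    push_cast
    have h1 : (k : ℝ) ≤ L ^ (2 / 5 : ℝ) := Nat.floor_le (by positivity)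
    have h2 : 1 ≤ L ^ (2 / 5 : ℝ) := Real.one_le_rpow hL1 (by norm_num)
    linarith
  have hk3 : ((k + 1 : ℕ) : ℝ) ≤ L := by
    refine hk2.trans ?_
    have h1 : L ^ (2 / 5 : ℝ) ≤ L ^ (1 / 2 : ℝ) := Real.rpow_le_rpow_of_exponent_le hL1 (by norm_num)
    have h2 : L ^ (1 / 2 : ℝ) * L ^ (1 / 2 : ℝ) = L := by
      rw [← Real.rpow_add hL0]; norm_num
    have h3 : 2 ≤ L ^ (1 / 2 : ℝ) := by
      by_contra! h
      nlinarith [Real.rpow_nonneg hL0.le (1 / 2 : ℝ)]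
    nlinarith
  have hqε : (q : ℝ) ^ (2 * ε) ≤ L ^ (1 / 10 : ℝ) := by
    calc (q : ℝ) ^ (2 * ε) ≤ (L ^ C) ^ (2 * ε) := by gcongr
      _ = L ^ (C * (2 * ε)) := (Real.rpow_mul hL0.le _ _).symm
      _ ≤ _ := by
        apply Real.rpow_le_rpow_of_exponent_le hL1
        calc C * (2 * ε) ≤ C * (2 * (1 / (20 * C))) := by gcongr; exact min_le_left _ _
          _ = _ := by field_simp; norm_num
  have hE : ((k + 1).factorial : ℝ) ^ 2 * (D * (q : ℝ) ^ (2 * ε)) ^ (k + 1) * (q * L) ≤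
      L ^ k * L ^ (C + 2) * Real.exp (-(4 * y)) := by
    have hfac : ((k + 1).factorial : ℝ) ≤ (2 * L ^ (2 / 5 : ℝ)) ^ (k + 1) := by
      calc ((k + 1).factorial : ℝ) ≤ ((k + 1 : ℕ) : ℝ) ^ (k + 1) := by
            exact_mod_cast Nat.factorial_le_pow _
        _ ≤ _ := by gcongr
    have hbase : (2 * L ^ (2 / 5 : ℝ)) ^ 2 * (D * L ^ (1 / 10 : ℝ)) ≤ L * Real.exp (-1) := by
      have h1 : (L ^ (2 / 5 : ℝ)) ^ 2 * L ^ (1 / 10 : ℝ) * L ^ (1 / 10 : ℝ) = L := by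
        rw [← Real.rpow_natCast, ← Real.rpow_mul hL0.le, ← Real.rpow_add hL0, ← Real.rpow_add hL0]
        norm_num
      have h2 : 4 * D ≤ L ^ (1 / 10 : ℝ) * Real.exp (-1) := by
        rw [Real.exp_neg, ← div_eq_mul_inv, le_div_iff₀ (Real.exp_pos _)]
        nlinarith [Real.exp_one_lt_d9]
      calc (2 * L ^ (2 / 5 : ℝ)) ^ 2 * (D * L ^ (1 / 10 : ℝ)) =
            (L ^ (2 / 5 : ℝ)) ^ 2 * L ^ (1 / 10 : ℝ) * (4 * D) := by ring
        _ ≤ (L ^ (2 / 5 : ℝ)) ^ 2 * L ^ (1 / 10 : ℝ) * (L ^ (1 / 10 : ℝ) * Real.exp (-1)) := by gcongr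
        _ = _ := by rw [← mul_assoc, h1]
    have hLC : L ^ C * L * L = L ^ (C + 2) := by
      rw [Real.rpow_add hL0, Real.rpow_two]; ring
    calc ((k + 1).factorial : ℝ) ^ 2 * (D * (q : ℝ) ^ (2 * ε)) ^ (k + 1) * (q * L)
        ≤ ((2 * L ^ (2 / 5 : ℝ)) ^ (k + 1)) ^ 2 * (D * L ^ (1 / 10 : ℝ)) ^ (k + 1) * (L ^ C * L) := by
          gcongr
      _ = ((2 * L ^ (2 / 5 : ℝ)) ^ 2 * (D * L ^ (1 / 10 : ℝ))) ^ (k + 1) * (L ^ C * L) := by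
          rw [mul_pow ((2 * L ^ (2 / 5 : ℝ)) ^ 2), pow_right_comm]
      _ ≤ (L * Real.exp (-1)) ^ (k + 1) * (L ^ C * L) := by gcongr
      _ = L ^ k * (L ^ C * L * L) * Real.exp (-((k + 1 : ℕ) : ℝ)) := by
          rw [mul_pow, ← Real.exp_nat_mul, pow_succ]; ring_nf
      _ ≤ L ^ k * (L ^ C * L * L) * Real.exp (-(4 * y)) := by
          gcongr
          exact hy6.trans hk1
      _ = _ := by rw [hLC]
  set h := X * Real.exp (-(2 * y)) with hh
  have hh0 : 0 < h := by positivity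
  have hh1 : 1 ≤ h := by
    rw [hh, hXL, ← Real.exp_add]
    apply Real.one_le_exp
    nlinarith
  have hhX : h ≤ X := mul_le_of_le_one_right hX0.le (by rw [Real.exp_le_one_iff]; linarith)
  have heX : Real.exp 1 ≤ X := by rw [hXL]; exact Real.exp_le_exp.mpr hL1
  have hR : ∀ n : ℕ, (n : ℝ) ≤ x + h → ‖vonMangoldtLogPow χ k n‖ ≤ 3 * L ^ (k + 1) := by
    intro n hn
    have hX1 : 1 ≤ X := (le_max_right _ _).trans hX
    refine (norm_vonMangoldtLogPow_le χ k (by linarith : 1 ≤ 2 * X) (by linarith)).trans ?_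
    have h1 : Real.log (2 * X) ≤ L * Real.exp (1 / L) := by
      rw [Real.log_mul (by norm_num) hX0.ne', ← hL]
      have h2 := Real.add_one_le_exp (1 / L)
      calc Real.log 2 + L ≤ L * (1 / L + 1) := by
            rw [mul_add, mul_one_div_cancel hL0.ne']
            linarith [Real.log_two_lt_d9]
        _ ≤ _ := by gcongr
    calc Real.log (2 * X) ^ (k + 1) ≤ (L * Real.exp (1 / L)) ^ (k + 1) := by
          gcongr
          exact Real.log_nonneg (by linarith)
      _ = L ^ (k + 1) * Real.exp (((k + 1 : ℕ) : ℝ) * (1 / L)) := by rw [mul_pow, ← Real.exp_nat_mul]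
      _ ≤ L ^ (k + 1) * Real.exp 1 := by
          gcongr
          rw [mul_one_div, div_le_one hL0]
          exact hk3
      _ ≤ L ^ (k + 1) * 3 := by
          gcongr
          linarith [Real.exp_one_lt_d9]
      _ = _ := mul_comm _ _
  have hmain := norm_sum_le_of_smoothed hx.le hh1 (hB q χ hχ hp k X x heX hx (by linarith))
    (hB q χ hχ hp k X (x + h) heX (by linarith) (by linarith)) hR
  refine hmain.trans ?_
  have hexp4 : Real.exp (-(4 * y)) = Real.exp (-(2 * y)) * (Real.exp (-y) * Real.exp (-y)) := by
    rw [← Real.exp_add, ← Real.exp_add]; ring_nf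
  have hexp2 : Real.exp (-(2 * y)) = Real.exp (-y) * Real.exp (-y) := by
    rw [← Real.exp_add]; ring_nf
  have hkey : L ^ (C + 2) * Real.exp (-y) ≤ L ^ (-C) := by
    rw [Real.exp_neg, ← div_eq_mul_inv, div_le_iff₀ (Real.exp_pos _)]
    calc L ^ (C + 2) = L ^ (-C) * L ^ (2 * C + 2) := by rw [← Real.rpow_add hL0]; ring_nf
      _ ≤ _ := by gcongr
  have hkey1 : L * Real.exp (-y) ≤ L ^ (-C) := by
    refine le_trans ?_ hkey
    gcongr
    calc L = L ^ (1 : ℝ) := (Real.rpow_one _).symm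
      _ ≤ _ := Real.rpow_le_rpow_of_exponent_le hL1 (by linarith)
  have hfirst : 2 * (J * (((k + 1).factorial : ℝ) ^ 2 * (D * (q : ℝ) ^ (2 * ε)) ^ (k + 1) * (q * L)) *
      X ^ 2) / h ≤ 2 * J * (L ^ k * X * (L ^ (-C) * Real.exp (-y))) := by
    rw [div_le_iff₀ hh0]
    calc 2 * (J * (((k + 1).factorial : ℝ) ^ 2 * (D * (q : ℝ) ^ (2 * ε)) ^ (k + 1) * (q * L)) * X ^ 2)
        ≤ 2 * (J * (L ^ k * L ^ (C + 2) * Real.exp (-(4 * y))) * X ^ 2) := by gcongr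
      _ = 2 * J * (L ^ k * X * ((L ^ (C + 2) * Real.exp (-y)) * Real.exp (-y))) *
          (X * Real.exp (-(2 * y))) := by rw [hexp4]; ring
      _ ≤ _ := by rw [← hh]; gcongr
  have hsecond : 2 * h * (3 * L ^ (k + 1)) ≤ 12 * (L ^ k * X * (L ^ (-C) * Real.exp (-y))) := by
    calc 2 * h * (3 * L ^ (k + 1)) = 6 * (L ^ k * X * ((L * Real.exp (-y)) * Real.exp (-y))) := by
          rw [hh, hexp2]; ring
      _ ≤ 6 * (L ^ k * X * (L ^ (-C) * Real.exp (-y))) := by gcongr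
      _ ≤ _ := by gcongr; norm_num
  linarith

end DirichletCharacter

end

section

open Filter Topology

theorem sum_Ioc_mul_eq_sum_mul_sub {R : Type*} [CommRing R] (v b : ℕ → R) {M n : ℕ} (hn : M ≤ n) :
    ∑ i ∈ Finset.Ioc M n, b i * v i = (∑ j ∈ Finset.Ioc M n, b j) * v (n + 1) +
      ∑ i ∈ Finset.Ioc M n, (∑ j ∈ Finset.Ioc M i, b j) * (v i - v (i + 1)) := by
  induction n, hn using Nat.le_induction with
  | base => simp
  | succ n hn ih =>
    rw [Finset.sum_Ioc_succ_top hn, Finset.sum_Ioc_succ_top hn (fun i => (∑ j ∈ _, b j) * _), ih,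
      Finset.sum_Ioc_succ_top hn]
    ring

/-- Abel's inequality for a nonincreasing nonnegative weight. -/
theorem norm_sum_Ioc_mul_le_of_antitone {v : ℕ → ℝ} {b : ℕ → ℂ} {M N : ℕ} {A : ℝ} (hMN : M ≤ N)
    (hv : ∀ i, M < i → v (i + 1) ≤ v i) (hv0 : 0 ≤ v (N + 1))
    (hA : ∀ i, M ≤ i → i ≤ N → ‖∑ j ∈ Finset.Ioc M i, b j‖ ≤ A) :
    ‖∑ i ∈ Finset.Ioc M N, b i * (v i : ℂ)‖ ≤ A * v (M + 1) := by
  have htel : ∑ i ∈ Finset.Ioc M N, (v i - v (i + 1)) = v (M + 1) - v (N + 1) := by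
    clear hv0 hA
    induction N, hMN using Nat.le_induction with
    | base => simp
    | succ n hn ih => rw [Finset.sum_Ioc_succ_top hn, ih]; ring
  rw [sum_Ioc_mul_eq_sum_mul_sub (fun i => (v i : ℂ)) b hMN]
  refine (norm_add_le _ _).trans ?_
  have h1 : ‖(∑ j ∈ Finset.Ioc M N, b j) * (v (N + 1) : ℂ)‖ ≤ A * v (N + 1) := by
    rw [norm_mul, Complex.norm_real, Real.norm_of_nonneg hv0]
    gcongr
    exact hA N hMN le_rfl
  have h2 : ‖∑ i ∈ Finset.Ioc M N, (∑ j ∈ Finset.Ioc M i, b j) * ((v i : ℂ) - (v (i + 1) : ℂ))‖ ≤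
      ∑ i ∈ Finset.Ioc M N, A * (v i - v (i + 1)) := by
    refine norm_sum_le_of_le _ fun i hi => ?_
    rw [Finset.mem_Ioc] at hi
    have h3 := sub_nonneg.mpr (hv i hi.1)
    rw [norm_mul, ← Complex.ofReal_sub, Complex.norm_real, Real.norm_of_nonneg h3]
    exact mul_le_mul_of_nonneg_right (hA i hi.1.le hi.2) h3
  rw [← Finset.mul_sum, htel] at h2
  linarith

theorem rpow_add_one_sub_rpow_antitone {γ : ℝ} (hγ0 : 0 ≤ γ) (hγ1 : γ ≤ 1) {x : ℝ} (hx : 0 ≤ x) :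
    (x + 1 + 1) ^ γ - (x + 1) ^ γ ≤ (x + 1) ^ γ - x ^ γ := by
  have h := (Real.concaveOn_rpow hγ0 hγ1).slope_anti_adjacent (x := x) (y := x + 1) (z := x + 1 + 1)
    hx (by simp only [Set.mem_Ici]; linarith) (by linarith) (by linarith)
  simpa using h

theorem rpow_add_one_sub_rpow_le {γ : ℝ} (hγ0 : 0 ≤ γ) (hγ1 : γ ≤ 1) {x : ℝ} (hx : 0 < x) :
    (x + 1) ^ γ - x ^ γ ≤ x ^ (γ - 1) := by
  have h1 : (x + 1) ^ γ = x ^ γ * (1 + 1 / x) ^ γ := by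
    rw [← Real.mul_rpow hx.le (by positivity)]
    congr 1
    field_simp
  have h2 : (1 + 1 / x) ^ γ ≤ 1 + γ * (1 / x) :=
    rpow_one_add_le_one_add_mul_self ((by norm_num : (-1 : ℝ) ≤ 0).trans (by positivity)) hγ0 hγ1
  rw [h1, Real.rpow_sub_one hx.ne']
  calc x ^ γ * (1 + 1 / x) ^ γ - x ^ γ ≤ x ^ γ * (1 + γ * (1 / x)) - x ^ γ := by gcongr
    _ = γ * (x ^ γ / x) := by ring
    _ ≤ _ := mul_le_of_le_one_left (by positivity) hγ1

namespace DirichletCharacter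

theorem ne_one_of_isPrimitive {q : ℕ} [NeZero q] {χ : DirichletCharacter ℂ q} (hq : q ≠ 1)
    (hχ : χ.IsPrimitive) : χ ≠ 1 := by
  rintro rfl
  rw [isPrimitive_def, conductor_one] at hχ
  exact hq hχ.symm

theorem sum_le_totient_mul {q : ℕ} [NeZero q] [Fintype (DirichletCharacter ℂ q)]
    {f : DirichletCharacter ℂ q → ℝ} {A : ℝ} (h : ∀ χ, f χ ≤ A) :
    ∑ χ, f χ ≤ (q.totient : ℝ) * A := by
  refine (Finset.sum_le_card_nsmul _ _ A fun χ _ => h χ).trans_eq ?_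
  rw [nsmul_eq_mul, Finset.card_univ, ← Nat.card_eq_fintype_card,
    card_eq_totient_of_hasEnoughRootsOfUnity]

theorem exists_norm_sum_vonMangoldt_mul_rpow_le {μ γ C : ℝ} (hμ0 : 0 < μ) (hμ1 : μ < 1)
    (hγ0 : 0 < γ) (hγ1 : γ < 1) (hC : 0 < C) :
    ∃ K > 0, ∃ X₀ : ℝ, ∀ X : ℝ, X₀ ≤ X → 0 < Real.log X ∧
      ∀ (q : ℕ) [NeZero q] (χ : DirichletCharacter ℂ q), χ ≠ 1 →
      χ.IsPrimitive → (q : ℝ) ≤ Real.log X ^ C →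
        ‖∑ n ∈ Finset.Ioc ⌊μ * X⌋₊ ⌊X⌋₊, (ArithmeticFunction.vonMangoldt n : ℂ) * χ (n : ZMod q)
          * ((((n : ℝ) + 1) ^ γ - (n : ℝ) ^ γ : ℝ) : ℂ)‖ ≤
          K * (X ^ γ / Real.exp (Real.log X ^ ((1 : ℝ) / 3))) * Real.log X ^ (-C) := by
  obtain ⟨K, hK, X₁, hB⟩ := exists_norm_sum_vonMangoldtLogPow_le hC
  set m := -Real.log μ with hm
  have hm0 : 0 < m := neg_pos.mpr (Real.log_neg hμ0 hμ1)
  have hev : ∀ᶠ L : ℝ in atTop, 2 * m + 2 ≤ L ∧ 2 * m ≤ L ^ (3 / 5 : ℝ) :=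
    (eventually_ge_atTop _).and ((tendsto_rpow_atTop (by norm_num)).eventually_ge_atTop _)
  obtain ⟨X₂, hX₂⟩ := eventually_atTop.mp (Real.tendsto_log_atTop.eventually hev)
  refine ⟨6 * K * μ ^ (γ - 1), by positivity, max (max X₁ X₂) 1, fun X hX => ?_⟩
  have hX1 : 1 ≤ X := (le_max_right _ _).trans hX
  obtain ⟨hLm, hLm'⟩ := hX₂ X ((le_max_right _ _).trans ((le_max_left _ _).trans hX))
  replace hB := hB X ((le_max_left _ _).trans ((le_max_left _ _).trans hX))
  set L := Real.log X with hL
  have hL0 : 0 < L := by linarith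
  refine ⟨hL0, fun q _ χ hχ hp hq => ?_⟩
  have hX0 : 0 < X := by linarith
  set k := ⌊L ^ (2 / 5 : ℝ)⌋₊ with hk
  set M := ⌊μ * X⌋₊ with hM
  set N := ⌊X⌋₊ with hN
  have hlogμX : Real.log (μ * X) = L - m := by
    rw [Real.log_mul hμ0.ne' hX0.ne', hm, ← hL]; ring
  have hμX0 : 0 < μ * X := by positivity
  have hμX : 1 ≤ μ * X := by
    by_contra! h
    have := Real.log_neg hμX0 h
    linarith
  have hM1 : 1 ≤ M := Nat.le_floor (by simpa using hμX)
  have hMN : M ≤ N := Nat.floor_mono (by nlinarith)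
  have hpartial : ∀ i : ℕ, 1 ≤ i → i ≤ N → ‖∑ n ∈ Finset.Ioc 0 i, vonMangoldtLogPow χ k n‖ ≤
      K * (L ^ k * X * (L ^ (-C) * Real.exp (-L ^ (1 / 3 : ℝ)))) := by
    intro i hi hiN
    have h := hB q χ hχ hp hq i (by exact_mod_cast hi) ((Nat.le_floor_iff hX0.le).mp hiN)
    rwa [Nat.floor_natCast] at h
  set A := K * (L ^ k * X * (L ^ (-C) * Real.exp (-L ^ (1 / 3 : ℝ)))) with hA
  set v : ℕ → ℝ := fun n => (((n : ℝ) + 1) ^ γ - (n : ℝ) ^ γ) / Real.log n ^ k with hv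
  have hlogpos : ∀ i : ℕ, M < i → 0 < Real.log i := fun i hi =>
    Real.log_pos (by exact_mod_cast hM1.trans_lt hi)
  have hw0 : ∀ i : ℕ, 0 ≤ ((i : ℝ) + 1) ^ γ - (i : ℝ) ^ γ := fun i =>
    sub_nonneg.mpr (Real.rpow_le_rpow (by positivity) (by linarith) hγ0.le)
  have hvanti : ∀ i, M < i → v (i + 1) ≤ v i := by
    intro i hi
    rw [hv]
    have h1 := hlogpos i hi
    have hi0 : (0 : ℝ) < i := by exact_mod_cast (Nat.zero_lt_of_lt hi)
    have h2 : Real.log i ≤ Real.log ((i + 1 : ℕ) : ℝ) :=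
      Real.log_le_log hi0 (by push_cast; linarith)
    refine div_le_div₀ (hw0 i) ?_ (by positivity) (by gcongr)
    push_cast
    exact rpow_add_one_sub_rpow_antitone hγ0.le hγ1.le hi0.le
  have hv0 : 0 ≤ v (N + 1) := div_nonneg (hw0 _) (pow_nonneg (hlogpos _ (by omega)).le _)
  have habel := norm_sum_Ioc_mul_le_of_antitone (b := vonMangoldtLogPow χ k) (A := A + A) hMN hvanti hv0 <| by
    intro i hMi hiN
    have hs := Finset.sum_Ioc_consecutive (vonMangoldtLogPow χ k) (Nat.zero_le M) hMi
    rw [← sub_eq_iff_eq_add'.mpr hs.symm]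
    exact (norm_sub_le _ _).trans (add_le_add (hpartial i (hM1.trans hMi) hiN) (hpartial M hM1 hMN))
  have hsum : ∑ n ∈ Finset.Ioc M N, (ArithmeticFunction.vonMangoldt n : ℂ) * χ (n : ZMod q)
      * ((((n : ℝ) + 1) ^ γ - (n : ℝ) ^ γ : ℝ) : ℂ) =
      ∑ n ∈ Finset.Ioc M N, vonMangoldtLogPow χ k n * (v n : ℂ) := by
    refine Finset.sum_congr rfl fun n hn => ?_
    have h1 : (Real.log n : ℂ) ≠ 0 := by
      exact_mod_cast (hlogpos n (Finset.mem_Ioc.mp hn).1).ne'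
    rw [hv, vonMangoldtLogPow, Complex.ofReal_div, Complex.ofReal_pow]
    field_simp
  rw [hsum]
  refine habel.trans ?_
  have hM1' : μ * X ≤ ((M + 1 : ℕ) : ℝ) := by
    push_cast
    exact (Nat.lt_floor_add_one _).le
  have hlogM : L - m ≤ Real.log ((M + 1 : ℕ) : ℝ) := hlogμX ▸ Real.log_le_log hμX0 hM1'
  have hvM : v (M + 1) ≤ (μ * X) ^ (γ - 1) / (L - m) ^ k := by
    rw [hv]
    refine div_le_div₀ (by positivity) ?_ (pow_pos (by linarith) k) (by gcongr; linarith)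
    refine (rpow_add_one_sub_rpow_le hγ0.le hγ1.le (by positivity)).trans ?_
    exact Real.rpow_le_rpow_of_nonpos hμX0 hM1' (by linarith)
  have hLk : L ^ k ≤ 3 * (L - m) ^ k := by
    have hLm0 : 0 < L - m := by linarith
    have h1 : L ≤ (L - m) * Real.exp (m / (L - m)) := by
      have h2 := Real.add_one_le_exp (m / (L - m))
      calc L = (L - m) * (m / (L - m) + 1) := by field_simp; ring
        _ ≤ _ := by gcongr
    have h3 : (k : ℝ) * (m / (L - m)) ≤ 1 := by
      have hk1 : (k : ℝ) ≤ L ^ (2 / 5 : ℝ) := Nat.floor_le (by positivity)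
      have h4 : L ^ (2 / 5 : ℝ) * L ^ (3 / 5 : ℝ) = L := by
        rw [← Real.rpow_add hL0]; norm_num
      rw [← mul_div_assoc, div_le_one hLm0]
      have h5 : (k : ℝ) * (2 * m) ≤ L ^ (2 / 5 : ℝ) * L ^ (3 / 5 : ℝ) := by gcongr
      linarith
    calc L ^ k ≤ ((L - m) * Real.exp (m / (L - m))) ^ k := by gcongr
      _ = (L - m) ^ k * Real.exp (k * (m / (L - m))) := by rw [mul_pow, ← Real.exp_nat_mul]
      _ ≤ (L - m) ^ k * Real.exp 1 := by gcongr
      _ ≤ (L - m) ^ k * 3 := by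
          gcongr
          linarith [Real.exp_one_lt_d9]
      _ = _ := mul_comm _ _
  have hLmk : 0 < (L - m) ^ k := pow_pos (by linarith) k
  calc (A + A) * v (M + 1)
      ≤ (A + A) * ((μ * X) ^ (γ - 1) / (L - m) ^ k) := by gcongr
    _ = 2 * K * (μ * X) ^ (γ - 1) * X * L ^ (-C) * Real.exp (-L ^ (1 / 3 : ℝ)) *
        (L ^ k / (L - m) ^ k) := by rw [hA]; ring
    _ ≤ 2 * K * (μ * X) ^ (γ - 1) * X * L ^ (-C) * Real.exp (-L ^ (1 / 3 : ℝ)) * 3 := by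
        gcongr
        rwa [div_le_iff₀ hLmk]
    _ = _ := by
        rw [Real.mul_rpow hμ0.le hX0.le, Real.rpow_sub_one hX0.ne', Real.exp_neg]
        field_simp
        ring

end DirichletCharacter

end

open Finset
open scoped Classical

/-- Bound on the average over primitive characters of sums of
`Λ(n) χ(n) ((n+1)^γ - n^γ)`. -/
theorem avg_primitive_char_gamma_difference (μ γ C : ℝ)
    (hμ0 : 0 < μ) (hμ1 : μ < 1) (hγ0 : 0 < γ) (hγ1 : γ < 1) (hC : 0 < C) :
    ∃ K > 0, ∃ X₀ : ℝ, ∀ X : ℝ, X₀ ≤ X →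
      ∑ q ∈ Ioc 1 ⌊Real.log X ^ C⌋₊, (1 / (Nat.totient q : ℝ)) *
          ∑ χ : DirichletCharacter ℂ q,
            (if χ.IsPrimitive then
              ‖∑ n ∈ Ioc ⌊μ * X⌋₊ ⌊X⌋₊,
                  (ArithmeticFunction.vonMangoldt n : ℂ) * χ (n : ZMod q)
                    * ((((n : ℝ) + 1) ^ γ - (n : ℝ) ^ γ : ℝ) : ℂ)‖
            else 0)
        ≤ K * (X ^ γ / Real.exp (Real.log X ^ ((1 : ℝ) / 3))) := by
  obtain ⟨K, hK, X₀, h⟩ :=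
    DirichletCharacter.exists_norm_sum_vonMangoldt_mul_rpow_le hμ0 hμ1 hγ0 hγ1 hC
  refine ⟨K, hK, max X₀ 0, fun X hX => ?_⟩
  obtain ⟨hL, hX'⟩ := h X ((le_max_left _ _).trans hX)
  have hX0 : 0 ≤ X := (le_max_right _ _).trans hX
  set L := Real.log X with hLdef
  set B := K * (X ^ γ / Real.exp (L ^ ((1 : ℝ) / 3))) with hB
  have hB0 : 0 ≤ B := by positivity
  have hLC : 0 < L ^ C := by positivity
  calc _ ≤ ∑ q ∈ Ioc 1 ⌊L ^ C⌋₊, B * L ^ (-C) := by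
        refine sum_le_sum fun q hq => ?_
        rw [mem_Ioc] at hq
        have : NeZero q := ⟨by omega⟩
        have hφ : (0 : ℝ) < q.totient := by exact_mod_cast Nat.totient_pos.mpr (NeZero.pos q)
        rw [one_div, inv_mul_le_iff₀ hφ]
        refine DirichletCharacter.sum_le_totient_mul fun χ => ?_
        split_ifs with hp
        · exact hX' q χ (DirichletCharacter.ne_one_of_isPrimitive hq.1.ne' hp) hp
            ((Nat.le_floor_iff hLC.le).mp hq.2)
        · positivity
    _ ≤ L ^ C * (B * L ^ (-C)) := by
        rw [sum_const, Nat.card_Ioc, nsmul_eq_mul]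
        gcongr
        refine le_trans ?_ (Nat.floor_le hLC.le)
        exact_mod_cast Nat.sub_le _ _
    _ = B := by
        rw [Real.rpow_neg hL.le]
        field_simp
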